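/- arXiv:1606.01921 — 2 statements merged into one kernel-verified Lean document; each statement's English description precedes it below -/
import Mathlib

section
/- The O_K̄-linear extension of the logarithmic derivative, dlog : O_K̄ ⊗_ℤ μ_{p^∞} → Ω¹_{O_K̄/O_K}, a ⊗ ζ ↦ a·ζ⁻¹·dζ, is surjective, and for a ∈ O_K̄ and a primitive p^r-th root of unity ζ ∈ K̄ the element a ⊗ ζ lies in the kernel of dlog if and only if v(a) ≥ r − v(D_{K/K₀}) − 1/(p−1). Consequently dlog induces an isomorphism (K̄/I_K) ⊗_{ℤ_p} ℤ_p(1) ≅ Ω¹_{O_K̄/O_K}, where I_K := {a ∈ K̄ : v(a) ≥ −v(D_{K/K₀}) − 1/(p−1)}. -/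
open Polynomial in
/-- If `S = A[γ]` with `A` integrally closed, an element `n` of an `S`-module killed by the
derivative of the minimal polynomial at `γ` is the value at `γ` of an `A`-linear derivation. -/
theorem exists_derivation_of_adjoin_eq_top {A S N : Type*} [CommRing A] [IsDomain A]
    [IsIntegrallyClosed A] [CommRing S] [IsDomain S] [Algebra A S] [Module.IsTorsionFree A S]
    [AddCommGroup N] [Module S N] [Module A N] [IsScalarTower A S N]
    {γ : S} (hγ : Algebra.adjoin A {γ} = ⊤) (hint : IsIntegral A γ) {n : N}
    (hn : aeval γ (derivative (minpoly A γ)) • n = 0) :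
    ∃ δ : Derivation A S N, δ γ = n := by
  have hsurj : Function.Surjective (aeval γ : A[X] →ₐ[A] S) := by
    rw [← AlgHom.range_eq_top, ← Algebra.adjoin_singleton_eq_range_aeval, hγ]
  have hwd : ∀ g h : A[X], aeval γ g = aeval γ h →
      aeval γ (derivative g) • n = aeval γ (derivative h) • n := by
    intro g h hgh
    have h0 : aeval γ (g - h) = 0 := by rw [map_sub, hgh, sub_self]
    obtain ⟨q, hq⟩ := minpoly.isIntegrallyClosed_dvd hint h0
    have h1 : aeval γ (derivative (g - h)) =
        aeval γ q * aeval γ (derivative (minpoly A γ)) := by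
      rw [hq]; simp [derivative_mul, mul_comm]
    rw [← sub_eq_zero, ← sub_smul, ← map_sub, ← derivative_sub, h1, mul_smul, hn, smul_zero]
  let lift : S → A[X] := Function.surjInv hsurj
  have hlift : ∀ s, aeval γ (lift s) = s := Function.surjInv_eq hsurj
  let φ : S →ₗ[A] N :=
    { toFun := fun s ↦ aeval γ (derivative (lift s)) • n
      map_add' := fun x y ↦ by
        rw [hwd (lift (x + y)) (lift x + lift y) (by simp [hlift])]
        simp [add_smul]
      map_smul' := fun a x ↦ by
        rw [hwd (lift (a • x)) (a • lift x) (by simp [hlift])]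
        simp }
  have hφ : ∀ g : A[X], φ (aeval γ g) = aeval γ (derivative g) • n :=
    fun g ↦ hwd _ _ (hlift _)
  refine ⟨Derivation.mk' φ fun x y ↦ ?_, ?_⟩
  · obtain ⟨g, rfl⟩ := hsurj x
    obtain ⟨h, rfl⟩ := hsurj y
    rw [← map_mul, hφ, hφ, hφ, derivative_mul]
    simp only [map_add, map_mul, add_smul, mul_smul]
    rw [smul_comm, add_comm]
  · have := hφ X
    simpa using this

open Polynomial in
/-- If `S = A[γ]` with `A` integrally closed, the annihilator of `dγ` is generated by the
derivative of the minimal polynomial at `γ`. -/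
theorem smul_D_eq_zero_iff_of_adjoin_eq_top {A S : Type*} [CommRing A] [IsDomain A]
    [IsIntegrallyClosed A] [CommRing S] [IsDomain S] [Algebra A S] [Module.IsTorsionFree A S]
    {γ : S} (hγ : Algebra.adjoin A {γ} = ⊤) (hint : IsIntegral A γ) (c : S) :
    c • KaehlerDifferential.D A S γ = 0 ↔ aeval γ (derivative (minpoly A γ)) ∣ c := by
  constructor
  · intro hc
    obtain ⟨δ, hδ⟩ := exists_derivation_of_adjoin_eq_top hγ hint
      (N := S ⧸ Ideal.span {aeval γ (derivative (minpoly A γ))}) (n := Ideal.Quotient.mk _ 1) (by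
        rw [← Ideal.Quotient.mk_eq_mk, ← Submodule.Quotient.mk_smul, smul_eq_mul, mul_one,
          Submodule.Quotient.mk_eq_zero]
        exact Ideal.mem_span_singleton_self _)
    have h := congrArg δ.liftKaehlerDifferential hc
    rw [map_smul, Derivation.liftKaehlerDifferential_comp_D, hδ, map_zero,
      ← Ideal.Quotient.mk_eq_mk, ← Submodule.Quotient.mk_smul, smul_eq_mul, mul_one,
      Submodule.Quotient.mk_eq_zero, Ideal.mem_span_singleton] at h
    exact h
  · rintro ⟨e, rfl⟩
    have := (KaehlerDifferential.D A S).map_aeval (minpoly A γ) γ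
    rw [minpoly.aeval, map_zero] at this
    rw [mul_comm, mul_smul, ← this, smul_zero]

open Polynomial in
theorem D_aeval_eq_smul_D {A B S : Type*} [CommRing A] [CommRing S] [Algebra A S]
    [CommRing B] [Algebra A B] [Algebra B S] [IsScalarTower A B S] (γ : S) (g : A[X]) :
    KaehlerDifferential.D B S (aeval γ g) =
      aeval γ (derivative g) • KaehlerDifferential.D B S γ :=
  ((KaehlerDifferential.D B S).restrictScalars A).map_aeval g γ

open Polynomial in
/-- The different of a monogenic extension is generated by the derivative of the minimal
polynomial at a generator. -/
theorem differentIdeal_eq_span_of_adjoin_eq_top {A S : Type*} [CommRing A] [IsDomain A]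
    [IsIntegrallyClosed A] [CharZero A] [CommRing S] [IsDedekindDomain S] [Algebra A S]
    [Module.IsTorsionFree A S] [Module.Finite A S]
    {γ : S} (hγ : Algebra.adjoin A {γ} = ⊤) :
    differentIdeal A S = Ideal.span {aeval γ (derivative (minpoly A γ))} := by
  let := FractionRing.liftAlgebra A (FractionRing S)
  have := FractionRing.isScalarTower_liftAlgebra A (FractionRing S)
  have : FiniteDimensional (FractionRing A) (FractionRing S) :=
    .of_isLocalization A S (nonZeroDivisors A)
  have : CharZero (FractionRing A) :=
    charZero_of_injective_algebraMap (IsFractionRing.injective A (FractionRing A))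
  have : IsIntegralClosure S A (FractionRing S) :=
    IsIntegralClosure.of_isIntegrallyClosed S A (FractionRing S)
  have htop : Algebra.adjoin (FractionRing A) {algebraMap S (FractionRing S) γ} = ⊤ := by
    have hS : ∀ s : S, algebraMap S (FractionRing S) s ∈
        Algebra.adjoin (FractionRing A) {algebraMap S (FractionRing S) γ} := by
      intro s
      have hs : s ∈ Algebra.adjoin A {γ} := hγ ▸ Algebra.mem_top
      rw [Algebra.adjoin_singleton_eq_range_aeval] at hs ⊢
      obtain ⟨g, rfl⟩ := hs
      refine ⟨g.map (algebraMap A (FractionRing A)), ?_⟩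
      simp [aeval_map_algebraMap, aeval_algebraMap_apply]
    refine eq_top_iff.mpr fun x _ ↦ ?_
    obtain ⟨s, t, ht, rfl⟩ := IsFractionRing.div_surjective (A := S) x
    rw [div_eq_mul_inv]
    refine mul_mem (hS s) ?_
    exact (Subalgebra.inv_mem_of_algebraic (A := Algebra.adjoin (FractionRing A)
      {algebraMap S (FractionRing S) γ}) (x := ⟨_, hS t⟩) (Algebra.IsAlgebraic.isAlgebraic _))
  have h := conductor_mul_differentIdeal A (FractionRing A) (FractionRing S) γ htop
  rwa [conductor_eq_top_iff_adjoin_eq_top.mpr hγ, Ideal.top_mul] at h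

open Polynomial in
/-- A derivation over `A` on `S` that kills a generator `ζ` of an `A`-algebra `R` kills the value
at `γ` of the derivative of every polynomial over `R` vanishing at `γ`, up to its value at `γ`. -/
theorem aeval_derivative_smul_eq_zero_of_map_eq_zero {A R S N : Type*} [CommRing A] [CommRing R]
    [CommRing S] [Algebra A R] [Algebra A S] [Algebra R S] [IsScalarTower A R S]
    [AddCommGroup N] [Module S N] [Module A N] [Module R N] [IsScalarTower A S N]
    [IsScalarTower R S N] (δ : Derivation A S N)
    {ζ : R} (hζ : Algebra.adjoin A {ζ} = ⊤) (hδ : δ (algebraMap R S ζ) = 0)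
    (γ : S) {H : R[X]} (hH : aeval γ H = 0) :
    aeval γ (derivative H) • δ γ = 0 := by
  have hkill : ∀ r : R, δ (algebraMap R S r) = 0 := by
    intro r
    have hr : r ∈ Algebra.adjoin A {ζ} := hζ ▸ Algebra.mem_top
    rw [Algebra.adjoin_singleton_eq_range_aeval] at hr
    obtain ⟨g, rfl⟩ := hr
    change δ (algebraMap R S (aeval ζ g)) = 0
    rw [← aeval_algebraMap_apply, δ.map_aeval, hδ, smul_zero]
  let φ : S →ₗ[R] N :=
    { toFun := δ
      map_add' := map_add δ
      map_smul' := fun r x ↦ by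
        rw [Algebra.smul_def, δ.leibniz, hkill, smul_zero, add_zero, algebraMap_smul]
        rfl }
  have := (Derivation.mk' φ fun x y ↦ δ.leibniz x y).map_aeval H γ
  rw [hH, map_zero] at this
  exact this.symm

/-- Transitivity of the different in characteristic zero. -/
theorem differentIdeal_eq_mul_of_charZero (A B S : Type*) [CommRing A] [IsDomain A]
    [IsIntegrallyClosed A] [CharZero A]
    [CommRing B] [IsDedekindDomain B] [Algebra A B] [Module.IsTorsionFree A B] [Module.Finite A B]
    [CommRing S] [IsDedekindDomain S]
    [Algebra A S] [Module.IsTorsionFree A S] [Module.Finite A S]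
    [Algebra B S] [Module.IsTorsionFree B S] [IsScalarTower A B S] :
    differentIdeal A S ≠ ⊥ ∧
      differentIdeal A S = differentIdeal B S * (differentIdeal A B).map (algebraMap B S) := by
  have : Module.Finite B S := .of_restrictScalars_finite A B S
  have : CharZero (FractionRing A) :=
    charZero_of_injective_algebraMap (IsFractionRing.injective A (FractionRing A))
  let := FractionRing.liftAlgebra A (FractionRing S)
  have := FractionRing.isScalarTower_liftAlgebra A (FractionRing S)
  have : FiniteDimensional (FractionRing A) (FractionRing S) :=
    .of_isLocalization A S (nonZeroDivisors A)
  exact ⟨differentIdeal_ne_bot, differentIdeal_eq_differentIdeal_mul_differentIdeal A B S⟩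

theorem adjoin_eq_top_of_isScalarTower {A B S : Type*} [CommRing A] [CommRing B] [CommRing S]
    [Algebra A B] [Algebra A S] [Algebra B S] [IsScalarTower A B S] {s : Set S}
    (hs : Algebra.adjoin A s = ⊤) : Algebra.adjoin B s = ⊤ := by
  have h : Algebra.adjoin A s ≤ (Algebra.adjoin B s).restrictScalars A :=
    Algebra.adjoin_le Algebra.subset_adjoin
  rw [hs] at h
  exact eq_top_iff.mpr fun x _ ↦ h Algebra.mem_top

open Polynomial in
/-- Given a local Dedekind domain `S = A[γ]` and Dedekind `A`-subalgebras `B` and `R = A[ζ]`, the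
annihilator of `dζ` in `Ω¹_{S/B}` consists of the `c` with `f'(ζ) ∣ c d`, where `f` is the minimal
polynomial of `ζ` and `d` generates the different of `B`. -/
theorem smul_D_algebraMap_eq_zero_iff {A B R S : Type*} [CommRing A] [IsDomain A]
    [IsIntegrallyClosed A] [CharZero A]
    [CommRing B] [IsDedekindDomain B] [Algebra A B] [Module.IsTorsionFree A B] [Module.Finite A B]
    [CommRing R] [IsDedekindDomain R] [Algebra A R] [Module.IsTorsionFree A R] [Module.Finite A R]
    [CommRing S] [IsDedekindDomain S] [IsLocalRing S]
    [Algebra A S] [Module.IsTorsionFree A S] [Module.Finite A S]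
    [Algebra B S] [Module.IsTorsionFree B S] [IsScalarTower A B S]
    [Algebra R S] [Module.IsTorsionFree R S] [IsScalarTower A R S]
    {γ : S} (hγ : Algebra.adjoin A {γ} = ⊤) {ζ : R} (hζ : Algebra.adjoin A {ζ} = ⊤)
    {d : B} (hd : differentIdeal A B = Ideal.span {d}) (c : S) :
    c • KaehlerDifferential.D B S (algebraMap R S ζ) = 0 ↔
      algebraMap R S (aeval ζ (derivative (minpoly A ζ))) ∣ c * algebraMap B S d := by
  have : Module.Finite B S := .of_restrictScalars_finite A B S
  have : Module.Finite R S := .of_restrictScalars_finite A R S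
  have : CharZero B := charZero_of_injective_algebraMap (FaithfulSMul.algebraMap_injective A B)
  have : CharZero R := charZero_of_injective_algebraMap (FaithfulSMul.algebraMap_injective A R)
  have hγB : Algebra.adjoin B {γ} = ⊤ := adjoin_eq_top_of_isScalarTower hγ
  have hγR : Algebra.adjoin R {γ} = ⊤ := adjoin_eq_top_of_isScalarTower hγ
  obtain ⟨hAS, hAB⟩ := differentIdeal_eq_mul_of_charZero A B S
  obtain ⟨-, hAR⟩ := differentIdeal_eq_mul_of_charZero A R S
  rw [hd, Ideal.map_span, Set.image_singleton, differentIdeal_eq_span_of_adjoin_eq_top hγB,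
    Ideal.span_singleton_mul_span_singleton] at hAB
  rw [differentIdeal_eq_span_of_adjoin_eq_top hζ, Ideal.map_span, Set.image_singleton,
    differentIdeal_eq_span_of_adjoin_eq_top hγR, Ideal.span_singleton_mul_span_singleton] at hAR
  rw [differentIdeal_eq_span_of_adjoin_eq_top hγ] at hAS hAB hAR
  rw [ne_eq, Ideal.span_singleton_eq_bot] at hAS
  rw [Ideal.span_singleton_eq_span_singleton] at hAB hAR
  set a := aeval γ (derivative (minpoly A γ))
  set g := aeval γ (derivative (minpoly B γ)) with hg
  set h := aeval γ (derivative (minpoly R γ)) with hh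
  set z := algebraMap R S (aeval ζ (derivative (minpoly A ζ)))
  set dS := algebraMap B S d
  obtain ⟨P, hP⟩ : ∃ P : A[X], aeval γ P = algebraMap R S ζ := by
    have hx : algebraMap R S ζ ∈ Algebra.adjoin A {γ} := hγ ▸ Algebra.mem_top
    rwa [Algebra.adjoin_singleton_eq_range_aeval] at hx
  set t := aeval γ (derivative P) with ht
  have hleft : c • KaehlerDifferential.D B S (algebraMap R S ζ) = 0 ↔ g ∣ c * t := by
    rw [← hP, D_aeval_eq_smul_D, smul_smul,
      smul_D_eq_zero_iff_of_adjoin_eq_top hγB (Algebra.IsIntegral.isIntegral γ)]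
  have hht : h ∣ t := by
    rw [hh, ← smul_D_eq_zero_iff_of_adjoin_eq_top hγR (Algebra.IsIntegral.isIntegral γ), ht,
      ← D_aeval_eq_smul_D, hP, Derivation.map_algebraMap]
  have hh0 : h ≠ 0 := fun h0 ↦ hAS (by simpa [h0] using hAR)
  have hg0 : g ≠ 0 := fun h0 ↦ hAS (by simpa [h0] using hAB)
  rw [hleft]
  by_cases hz : IsUnit z
  · refine iff_of_true ?_ hz.dvd
    have h1 : a ∣ h := hAR.dvd.trans (hz.mul_right_dvd.mpr dvd_rfl)
    exact (((dvd_mul_right g dS).trans hAB.symm.dvd).trans (h1.trans hht)).mul_left c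
  · have hmem : h ∈ Ideal.span {t, a} := by
      obtain ⟨δ, hδ⟩ := exists_derivation_of_adjoin_eq_top hγ (Algebra.IsIntegral.isIntegral γ)
        (N := S ⧸ Ideal.span {t, a}) (n := Ideal.Quotient.mk _ 1) (by
          rw [← Ideal.Quotient.mk_eq_mk, ← Submodule.Quotient.mk_smul, smul_eq_mul, mul_one,
            Submodule.Quotient.mk_eq_zero]
          exact Ideal.subset_span (by simp [a]))
      have hδζ : δ (algebraMap R S ζ) = 0 := by
        rw [← hP, δ.map_aeval, hδ, ← Ideal.Quotient.mk_eq_mk, ← Submodule.Quotient.mk_smul,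
          smul_eq_mul, mul_one, Submodule.Quotient.mk_eq_zero]
        exact Ideal.subset_span (by simp [t])
      have := aeval_derivative_smul_eq_zero_of_map_eq_zero δ hζ hδζ γ (minpoly.aeval R γ)
      rwa [hδ, ← Ideal.Quotient.mk_eq_mk, ← Submodule.Quotient.mk_smul,
          smul_eq_mul, mul_one, Submodule.Quotient.mk_eq_zero] at this
    obtain ⟨x, y, hxy⟩ := Ideal.mem_span_pair.mp hmem
    obtain ⟨u, hu⟩ := hAR.symm
    have hunit : IsUnit (1 - y * u * z) := by
      by_contra hcon
      have := (IsLocalRing.nonunits_add hcon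
        (show y * u * z ∈ nonunits S from fun h' ↦ hz (isUnit_of_mul_isUnit_right h')))
      simp at this
    have hth : t ∣ h := by
      have h2 : h * (1 - y * u * z) = t * x := by
        linear_combination -hxy - y * hu
      exact (hunit.dvd_mul_right).mp ⟨x, h2⟩
    have hassoc : Associated (c * t) (c * h) :=
      (associated_of_dvd_dvd hth hht).mul_left c
    rw [hassoc.dvd_iff_dvd_right]
    have hz0 : z ≠ 0 := fun h0 ↦ hAS (by simpa [h0] using hAR)
    rw [← mul_dvd_mul_iff_right hz0, mul_assoc c h z,
      ((hAR.symm.trans hAB).mul_left c).dvd_iff_dvd_right, mul_left_comm c g dS,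
      mul_dvd_mul_iff_left hg0]

open Polynomial IsLocalRing in
/-- A finite extension of discrete valuation rings with separable residue extension is
monogenic. -/
theorem exists_adjoin_eq_top_of_isDiscreteValuationRing (A S : Type*) [CommRing A] [IsDomain A]
    [IsDiscreteValuationRing A] [CommRing S] [IsDomain S] [IsDiscreteValuationRing S]
    [Algebra A S] [FaithfulSMul A S] [Module.Finite A S] [PerfectField (ResidueField A)] :
    ∃ γ : S, Algebra.adjoin A {γ} = ⊤ := by
  obtain ⟨π, hπ⟩ := IsDiscreteValuationRing.exists_irreducible S
  have hmπ : maximalIdeal S = Ideal.span {π} := hπ.maximalIdeal_eq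
  obtain ⟨β₀, hβ₀⟩ := Field.exists_primitive_element (ResidueField A) (ResidueField S)
  have hβint : IsIntegral (ResidueField A) β₀ := Algebra.IsIntegral.isIntegral _
  obtain ⟨f, hf, -, -⟩ := lifts_and_natDegree_eq_and_monic
    (map_surjective (residue A) residue_surjective (minpoly (ResidueField A) β₀))
    (minpoly.monic hβint)
  have hres : ∀ (q : A[X]) (x : S), residue S (aeval x q) = aeval (residue S x) (q.map (residue A)) :=
    fun q x ↦ map_aeval_eq_aeval_map (ψ := residue S) (φ := residue A) rfl q x
  -- a lift of `β₀` at which `f` takes a uniformizing value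
  obtain ⟨γ, hγ, hfγ⟩ : ∃ γ : S, residue S γ = β₀ ∧ maximalIdeal S = Ideal.span {aeval γ f} := by
    have key : ∀ x : S, residue S x = β₀ → ¬ π ^ 2 ∣ aeval x f →
        maximalIdeal S = Ideal.span {aeval x f} := by
      intro x hx hdvd
      have hmem : aeval x f ∈ maximalIdeal S := by
        rw [← residue_eq_zero_iff, hres, hx, hf, minpoly.aeval]
      rw [hmπ, Ideal.mem_span_singleton] at hmem
      obtain ⟨u, hu⟩ := hmem
      have huu : IsUnit u := by
        by_contra hcon
        have : u ∈ maximalIdeal S := hcon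
        rw [hmπ, Ideal.mem_span_singleton] at this
        obtain ⟨w, rfl⟩ := this
        exact hdvd ⟨w, by rw [hu]; ring⟩
      rw [hmπ, hu, Ideal.span_singleton_mul_right_unit huu]
    obtain ⟨β, hβ⟩ := residue_surjective (R := S) β₀
    by_cases h2 : π ^ 2 ∣ aeval β f
    · refine ⟨β + π, ?_, ?_⟩
      · rw [map_add, hβ, (residue_eq_zero_iff π).mpr (hmπ ▸ Ideal.mem_span_singleton_self π),
          add_zero]
      · refine key _ ?_ fun h3 ↦ ?_
        · rw [map_add, hβ, (residue_eq_zero_iff π).mpr (hmπ ▸ Ideal.mem_span_singleton_self π),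
            add_zero]
        obtain ⟨k, hk⟩ := (f.map (algebraMap A S)).binomExpansion β π
        rw [derivative_map, eval_map_algebraMap, eval_map_algebraMap, eval_map_algebraMap] at hk
        obtain ⟨u, hu⟩ := h2
        obtain ⟨v, hv⟩ := h3
        have hd : aeval β (derivative f) = π * (v - u - k) :=
          mul_right_cancel₀ hπ.ne_zero (by linear_combination hv - hk - hu)
        have hd0 : residue S (aeval β (derivative f)) = 0 := by
          rw [residue_eq_zero_iff, hmπ, hd, Ideal.mem_span_singleton]
          exact dvd_mul_right _ _
        rw [hres, ← derivative_map, hf, hβ] at hd0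
        exact (Algebra.IsSeparable.isSeparable (ResidueField A) β₀).aeval_derivative_ne_zero
          (minpoly.aeval _ _) hd0
    · exact ⟨β, hβ, key β hβ h2⟩
  refine ⟨γ, ?_⟩
  have hresγ : Algebra.adjoin (ResidueField A) {residue S γ} = ⊤ := by
    rw [hγ, ← IntermediateField.adjoin_simple_toSubalgebra_of_isAlgebraic
      (IsAlgebraic.of_finite _ _), hβ₀, IntermediateField.top_toSubalgebra]
  have hmod : ∀ s : S, ∃ t ∈ Algebra.adjoin A {γ}, ∃ w, s = t + aeval γ f * w := by
    intro s
    rw [Algebra.adjoin_singleton_eq_range_aeval, AlgHom.range_eq_top] at hresγ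
    obtain ⟨p, hp⟩ := hresγ (residue S s)
    obtain ⟨q, rfl⟩ := Polynomial.map_surjective _ residue_surjective p
    have hmem : s - aeval γ q ∈ maximalIdeal S := by
      rw [← residue_eq_zero_iff, map_sub, hres, ← hp, sub_self]
    rw [hfγ, Ideal.mem_span_singleton] at hmem
    obtain ⟨w, hw⟩ := hmem
    exact ⟨aeval γ q, Polynomial.aeval_mem_adjoin_singleton A γ, w, by rw [← hw]; ring⟩
  have hpow : ∀ (n : ℕ) (s : S), ∃ t ∈ Algebra.adjoin A {γ}, ∃ w, s = t + aeval γ f ^ n * w := by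
    intro n
    induction n with
    | zero => exact fun s ↦ ⟨0, zero_mem _, s, by simp⟩
    | succ n ih =>
      intro s
      obtain ⟨t, ht, w, rfl⟩ := ih s
      obtain ⟨t', ht', w', rfl⟩ := hmod w
      exact ⟨t + aeval γ f ^ n * t', add_mem ht (mul_mem (pow_mem
        (Polynomial.aeval_mem_adjoin_singleton A γ) n) ht'), w', by ring⟩
  have hne : (maximalIdeal A).map (algebraMap A S) ≠ ⊥ := by
    rw [ne_eq, Ideal.map_eq_bot_iff_of_injective (FaithfulSMul.algebraMap_injective A S)]
    exact IsDiscreteValuationRing.not_a_field A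
  obtain ⟨n, hn⟩ := IsDiscreteValuationRing.ideal_eq_span_pow_irreducible hne
    (show Irreducible (aeval γ f) from
      (IsDiscreteValuationRing.irreducible_iff_uniformizer _).mpr hfγ)
  rw [← Algebra.toSubmodule_eq_top, eq_top_iff]
  refine Submodule.le_of_le_smul_of_le_jacobson_bot
      (Module.finite_def.mp inferInstance) (IsLocalRing.maximalIdeal_le_jacobson ⊥)
      (?_ : ⊤ ≤ (Algebra.adjoin A {γ}).toSubmodule ⊔ maximalIdeal A • ⊤)
  intro s _
  obtain ⟨t, ht, w, rfl⟩ := hpow n s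
  rw [Ideal.smul_top_eq_map]
  refine Submodule.add_mem_sup ht ?_
  rw [Submodule.restrictScalars_mem, hn, Ideal.mem_span_singleton]
  exact dvd_mul_right _ _

open Polynomial in
theorem irreducible_cyclotomic_prime_pow_padicInt (p : ℕ) [Fact p.Prime] (k : ℕ) :
    Irreducible (cyclotomic (p ^ (k + 1)) ℤ_[p]) := by
  have hp : p.Prime := Fact.out
  have hmon : ((cyclotomic (p ^ (k + 1)) ℤ_[p]).comp (X + 1)).Monic := by
    have := (cyclotomic.monic (p ^ (k + 1)) ℤ_[p]).comp_X_add_C 1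
    rwa [C_1] at this
  have hE := cyclotomic_prime_pow_comp_X_add_one_isEisensteinAt p k
  have hmap : ((cyclotomic (p ^ (k + 1)) ℤ).comp (X + 1)).map (Int.castRingHom ℤ_[p]) =
      (cyclotomic (p ^ (k + 1)) ℤ_[p]).comp (X + 1) := by
    rw [map_comp, map_cyclotomic]; simp
  have hw := hE.isWeaklyEisensteinAt.map (Int.castRingHom ℤ_[p])
  rw [hmap, Ideal.submodule_span_eq, Ideal.map_span, Set.image_singleton] at hw
  have hpm : Ideal.span {(Int.castRingHom ℤ_[p]) (p : ℤ)} = IsLocalRing.maximalIdeal ℤ_[p] := by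
    rw [PadicInt.maximalIdeal_eq_span_p]; simp
  rw [hpm] at hw
  have hE' : ((cyclotomic (p ^ (k + 1)) ℤ_[p]).comp (X + 1)).IsEisensteinAt
      (IsLocalRing.maximalIdeal ℤ_[p]) := by
    refine hmon.isEisensteinAt_of_mem_of_notMem (Ideal.IsPrime.ne_top inferInstance)
      (fun hn ↦ hw.mem hn) ?_
    rw [coeff_zero_eq_eval_zero, eval_comp]
    simp only [eval_add, eval_X, eval_one, zero_add]
    rw [eval_one_cyclotomic_prime_pow, PadicInt.maximalIdeal_eq_span_p, Ideal.span_singleton_pow,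
      Ideal.mem_span_singleton]
    intro h
    have : ((p : ℤ_[p]) ^ 2) ∣ (p : ℤ_[p]) ^ 1 := by simpa using h
    exact absurd ((pow_dvd_pow_iff PadicInt.prime_p.ne_zero PadicInt.prime_p.not_isUnit).mp this)
      (by norm_num)
  have hdeg : 0 < ((cyclotomic (p ^ (k + 1)) ℤ_[p]).comp (X + 1)).natDegree := by
    have : (X + 1 : ℤ_[p][X]) = X + C 1 := by simp
    rw [natDegree_comp, this, natDegree_X_add_C, mul_one, natDegree_cyclotomic]
    exact Nat.totient_pos.mpr (pow_pos hp.pos _)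
  have hirr := hE'.irreducible inferInstance hmon.isPrimitive hdeg
  have h2 : (algEquivAevalXAddC (1 : ℤ_[p])) (cyclotomic (p ^ (k + 1)) ℤ_[p]) =
      (cyclotomic (p ^ (k + 1)) ℤ_[p]).comp (X + 1) := by
    simp [comp, aeval_def, eval₂_eq_eval_map]
  rw [← h2] at hirr
  exact (MulEquiv.irreducible_iff (algEquivAevalXAddC (1 : ℤ_[p]))).mp hirr

open Polynomial in
theorem minpoly_padicInt_eq_cyclotomic {p : ℕ} [Fact p.Prime] {R : Type*} [CommRing R] [IsDomain R]
    [CharZero R] [Algebra ℤ_[p] R] [Module.IsTorsionFree ℤ_[p] R] {k : ℕ} {ζ : R}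
    (hζ : IsPrimitiveRoot ζ (p ^ (k + 1))) :
    minpoly ℤ_[p] ζ = cyclotomic (p ^ (k + 1)) ℤ_[p] := by
  have hp : p.Prime := Fact.out
  have : NeZero (p ^ (k + 1)) := ⟨(pow_pos hp.pos _).ne'⟩
  have hint : IsIntegral ℤ_[p] ζ := (hζ.isIntegral (pow_pos hp.pos _)).tower_top
  have hroot : aeval ζ (cyclotomic (p ^ (k + 1)) ℤ_[p]) = 0 := by
    have := hζ.isRoot_cyclotomic (pow_pos hp.pos _)
    rwa [IsRoot, ← map_cyclotomic _ (algebraMap ℤ_[p] R), eval_map_algebraMap] at this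
  have hdvd := minpoly.isIntegrallyClosed_dvd hint hroot
  exact eq_of_monic_of_associated (minpoly.monic hint) (cyclotomic.monic _ _)
    (((irreducible_cyclotomic_prime_pow_padicInt p k).dvd_iff.mp hdvd).resolve_left
      (minpoly.not_isUnit ℤ_[p] ζ)).symm

open Polynomial in
theorem IsPrimitiveRoot.sub_one_dvd_of_prime_pow {p : ℕ} [Fact p.Prime] {R : Type*} [CommRing R]
    [IsDomain R] {k : ℕ} {ζ : R} (hζ : IsPrimitiveRoot ζ (p ^ (k + 1))) : ζ - 1 ∣ (p : R) := by
  have h := sub_dvd_eval_sub ζ 1 (cyclotomic (p ^ (k + 1)) R)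
  have hroot := hζ.isRoot_cyclotomic (pow_pos (Fact.out : p.Prime).pos _)
  rwa [hroot.eq_zero, eval_one_cyclotomic_prime_pow, zero_sub, dvd_neg] at h

theorem eq_span_sub_one_of_isMaximal {p : ℕ} [Fact p.Prime] {R : Type*} [CommRing R] [IsDomain R]
    [Algebra ℤ_[p] R] [Algebra.IsIntegral ℤ_[p] R] {k : ℕ} {ζ : R}
    (hζ : IsPrimitiveRoot ζ (p ^ (k + 1))) (hadj : Algebra.adjoin ℤ_[p] {ζ} = ⊤)
    (m : Ideal R) [m.IsMaximal] : m = Ideal.span {ζ - 1} := by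
  have hcomap : m.comap (algebraMap ℤ_[p] R) = IsLocalRing.maximalIdeal ℤ_[p] :=
    IsLocalRing.eq_maximalIdeal (Ideal.isMaximal_comap_of_isIntegral_of_isMaximal m)
  have hpm : (p : R) ∈ m := by
    have : (p : ℤ_[p]) ∈ m.comap (algebraMap ℤ_[p] R) := by
      rw [hcomap, PadicInt.maximalIdeal_eq_span_p]
      exact Ideal.mem_span_singleton_self _
    simpa using this
  have hζm : ζ - 1 ∈ m := by
    have hp0 : (p : R ⧸ m) = 0 := by
      rw [← map_natCast (Ideal.Quotient.mk m)]
      exact Ideal.Quotient.eq_zero_iff_mem.mpr hpm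
    have : CharP (R ⧸ m) p := (CharP.charP_iff_prime_eq_zero Fact.out).mpr hp0
    have h : (Ideal.Quotient.mk m ζ - 1) ^ p ^ (k + 1) = 0 := by
      rw [sub_pow_char_pow, ← map_pow, hζ.pow_eq_one, map_one, one_pow, sub_self]
    rw [← Ideal.Quotient.eq_zero_iff_mem, map_sub, map_one]
    exact eq_zero_of_pow_eq_zero h
  refine le_antisymm (fun x hx ↦ ?_) ((Ideal.span_singleton_le_iff_mem _).mpr hζm)
  obtain ⟨g, rfl⟩ : ∃ g : Polynomial ℤ_[p], Polynomial.aeval ζ g = x := by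
    have : x ∈ Algebra.adjoin ℤ_[p] {ζ} := hadj ▸ Algebra.mem_top
    rwa [Algebra.adjoin_singleton_eq_range_aeval] at this
  have hdiv : ζ - 1 ∣ Polynomial.aeval ζ g - algebraMap ℤ_[p] R (g.eval 1) := by
    have := Polynomial.sub_dvd_eval_sub ζ 1 (g.map (algebraMap ℤ_[p] R))
    rwa [Polynomial.eval_map_algebraMap, Polynomial.eval_one_map] at this
  have hmem : algebraMap ℤ_[p] R (g.eval 1) ∈ m := by
    have := m.sub_mem hx (m.mem_of_dvd hdiv hζm)
    simpa using this
  have hmem' : g.eval 1 ∈ IsLocalRing.maximalIdeal ℤ_[p] := hcomap ▸ hmem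
  rw [PadicInt.maximalIdeal_eq_span_p, Ideal.mem_span_singleton] at hmem'
  have hdvd : ζ - 1 ∣ algebraMap ℤ_[p] R (g.eval 1) := by
    refine hζ.sub_one_dvd_of_prime_pow.trans ?_
    simpa using map_dvd (algebraMap ℤ_[p] R) hmem'
  rw [Ideal.mem_span_singleton]
  simpa using dvd_add hdiv hdvd

theorem isDedekindDomain_of_adjoin_eq_top {p : ℕ} [Fact p.Prime] {R : Type*} [CommRing R]
    [IsDomain R] [Algebra ℤ_[p] R] [Module.Finite ℤ_[p] R] {k : ℕ} {ζ : R}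
    (hζ : IsPrimitiveRoot ζ (p ^ (k + 1))) (hadj : Algebra.adjoin ℤ_[p] {ζ} = ⊤) :
    IsDedekindDomain R := by
  have : IsNoetherianRing R := isNoetherian_of_tower ℤ_[p] (inferInstance : IsNoetherian ℤ_[p] R)
  have : IsLocalRing R := by
    obtain ⟨m, hm⟩ := Ideal.exists_maximal R
    refine .of_unique_max_ideal ⟨m, hm, fun n hn ↦ ?_⟩
    have := hn
    rw [eq_span_sub_one_of_isMaximal hζ hadj m, eq_span_sub_one_of_isMaximal hζ hadj n]
  have hm := eq_span_sub_one_of_isMaximal hζ hadj (IsLocalRing.maximalIdeal R)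
  have h := (tfae_of_isNoetherianRing_of_isLocalRing_of_isDomain R).out 2 4
  exact h.mpr ⟨_, hm⟩

open Polynomial in
theorem aeval_derivative_minpoly_padicInt_mul {p : ℕ} [Fact p.Prime] {R : Type*} [CommRing R]
    [IsDomain R] [CharZero R] [Algebra ℤ_[p] R] [Module.IsTorsionFree ℤ_[p] R] {k : ℕ} {ζ : R}
    (hζ : IsPrimitiveRoot ζ (p ^ (k + 1))) :
    aeval ζ (derivative (minpoly ℤ_[p] ζ)) * (ζ ^ p ^ k - 1) =
      (p : R) ^ (k + 1) * ζ ^ (p ^ (k + 1) - 1) := by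
  have hroot : aeval ζ (cyclotomic (p ^ (k + 1)) ℤ_[p]) = 0 := by
    rw [← minpoly_padicInt_eq_cyclotomic hζ, minpoly.aeval]
  have h := congrArg (fun f ↦ aeval ζ (derivative f))
    (cyclotomic_prime_pow_mul_X_pow_sub_one ℤ_[p] p k)
  simp only [derivative_mul, map_add, map_mul, hroot, zero_mul, add_zero] at h
  rw [minpoly_padicInt_eq_cyclotomic hζ]
  simpa [derivative_X_pow] using h

open Polynomial in
theorem spectralNorm_padic_le_one_iff {p : ℕ} [Fact p.Prime] {L : Type*} [Field L]
    [Algebra ℚ_[p] L] [Algebra ℤ_[p] L] [IsScalarTower ℤ_[p] ℚ_[p] L] [Algebra.IsAlgebraic ℚ_[p] L]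
    {x : L} : spectralNorm ℚ_[p] L x ≤ 1 ↔ IsIntegral ℤ_[p] x := by
  have hint : IsIntegral ℚ_[p] x := Algebra.IsIntegral.isIntegral x
  rw [spectralNorm, spectralValue_le_one_iff (minpoly.monic hint)]
  constructor
  · intro h
    have hlift : minpoly ℚ_[p] x ∈ lifts (algebraMap ℤ_[p] ℚ_[p]) :=
      (lifts_iff_coeff_lifts _).mpr fun n ↦ ⟨⟨_, h n⟩, rfl⟩
    obtain ⟨q, hq, -, hmon⟩ := lifts_and_natDegree_eq_and_monic hlift (minpoly.monic hint)
    refine ⟨q, hmon, ?_⟩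
    rw [← aeval_def, ← aeval_map_algebraMap ℚ_[p], hq, minpoly.aeval]
  · intro h n
    rw [minpoly.isIntegrallyClosed_eq_field_fractions' ℚ_[p] h, coeff_map]
    exact PadicInt.norm_le_one _

theorem spectralNorm_padic_mul {p : ℕ} [Fact p.Prime] {L : Type*} [Field L]
    [Algebra ℚ_[p] L] [Algebra.IsAlgebraic ℚ_[p] L] (x y : L) :
    spectralNorm ℚ_[p] L (x * y) = spectralNorm ℚ_[p] L x * spectralNorm ℚ_[p] L y :=
  map_mul (spectralMulAlgNorm ℚ_[p] L) x y

theorem isIntegral_padicInt_or_inv {p : ℕ} [Fact p.Prime] {L : Type*} [Field L]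
    [Algebra ℚ_[p] L] [Algebra ℤ_[p] L] [IsScalarTower ℤ_[p] ℚ_[p] L] [Algebra.IsAlgebraic ℚ_[p] L]
    (x : L) : IsIntegral ℤ_[p] x ∨ IsIntegral ℤ_[p] x⁻¹ := by
  rcases eq_or_ne x 0 with rfl | hx
  · exact .inl isIntegral_zero
  rw [← spectralNorm_padic_le_one_iff, ← spectralNorm_padic_le_one_iff]
  by_contra! h
  have h1 : spectralNorm ℚ_[p] L (x * x⁻¹) = 1 := by
    rw [mul_inv_cancel₀ hx, spectralNorm_one]
  rw [spectralNorm_padic_mul] at h1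
  nlinarith

theorem exists_isIntegral_pow_div {p : ℕ} [Fact p.Prime] {L : Type*} [Field L]
    [Algebra ℚ_[p] L] [Algebra ℤ_[p] L] [IsScalarTower ℤ_[p] ℚ_[p] L] [Algebra.IsAlgebraic ℚ_[p] L]
    {x : L} (hx : ¬ IsIntegral ℤ_[p] x) : ∃ n : ℕ, IsIntegral ℤ_[p] ((x⁻¹) ^ n / (p : L)) := by
  have hx0 : x ≠ 0 := by rintro rfl; exact hx isIntegral_zero
  rw [← spectralNorm_padic_le_one_iff, not_le] at hx
  set N := spectralMulAlgNorm ℚ_[p] L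
  have hN : ∀ y, spectralNorm ℚ_[p] L y = N y := fun _ ↦ rfl
  have hinv : N x * N x⁻¹ = 1 := by
    rw [← map_mul, mul_inv_cancel₀ hx0, ← hN, spectralNorm_one]
  have h0 : 0 ≤ N x⁻¹ := apply_nonneg N _
  have hlt : N x⁻¹ < 1 := by rw [hN] at hx; nlinarith
  have hc : 0 < N (p : L)⁻¹ := by
    have : (p : L) ≠ 0 := by
      have : CharZero L :=
        charZero_of_injective_algebraMap (FaithfulSMul.algebraMap_injective ℚ_[p] L)
      exact_mod_cast (Fact.out : p.Prime).ne_zero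
    refine lt_of_le_of_ne (apply_nonneg N _) fun h ↦ ?_
    exact inv_ne_zero this (eq_zero_of_map_eq_zero N h.symm)
  obtain ⟨n, hn⟩ := exists_pow_lt_of_lt_one (inv_pos.mpr hc) hlt
  refine ⟨n, ?_⟩
  rw [← spectralNorm_padic_le_one_iff, hN, div_eq_mul_inv, map_mul, map_pow]
  calc N x⁻¹ ^ n * N (p : L)⁻¹ ≤ (N (p : L)⁻¹)⁻¹ * N (p : L)⁻¹ := by gcongr
    _ = 1 := inv_mul_cancel₀ hc.ne'

open Polynomial in
theorem IsPrimitiveRoot.associated_sub_one_pow_prime {p : ℕ} [Fact p.Prime] {R : Type*}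
    [CommRing R] [IsDomain R] {ζ : R} (hζ : IsPrimitiveRoot ζ p) :
    Associated ((ζ - 1) ^ (p - 1)) (p : R) := by
  have hp : p.Prime := Fact.out
  obtain ⟨n, rfl⟩ : ∃ n, p = n + 1 := ⟨p - 1, by have := hp.pos; omega⟩
  have h := hζ.prod_pow_sub_one_eq_order
  rw [Nat.add_sub_cancel, Nat.cast_add, Nat.cast_one, ← h]
  have h1 : Associated ((ζ - 1) ^ n) (∏ k ∈ Finset.range n, (ζ ^ (k + 1) - 1)) := by
    rw [← Finset.card_range n, ← Finset.prod_const, Finset.card_range]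
    refine Associated.prod _ _ _ fun i hi ↦ ?_
    refine hζ.associated_sub_one_pow_sub_one_of_coprime (Nat.Coprime.symm ?_)
    refine hp.coprime_iff_not_dvd.mpr (Nat.not_dvd_of_pos_of_lt (Nat.succ_pos _) ?_)
    simpa using Finset.mem_range.mp hi
  exact h1.trans (associated_unit_mul_right _ _ (isUnit_one.neg.pow n))

section Valuation

variable {p : ℕ} [Fact p.Prime] {L : Type*} [Field L]
  [Algebra ℚ_[p] L] [Algebra ℤ_[p] L] [IsScalarTower ℤ_[p] ℚ_[p] L] [Algebra.IsAlgebraic ℚ_[p] L]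
  {C : Type*} [CommRing C] [Algebra C L] [IsIntegralClosure C ℤ_[p] L] {v : L → ℚ}

theorem map_one_eq_zero_of_map_mul (hv_mul : ∀ x y : L, x ≠ 0 → y ≠ 0 → v (x * y) = v x + v y) :
    v 1 = 0 := by
  have := hv_mul 1 1 one_ne_zero one_ne_zero
  rw [mul_one] at this
  linarith

theorem map_pow_of_map_mul (hv_mul : ∀ x y : L, x ≠ 0 → y ≠ 0 → v (x * y) = v x + v y)
    {x : L} (hx : x ≠ 0) (n : ℕ) : v (x ^ n) = n * v x := by
  induction n with
  | zero => simp [map_one_eq_zero_of_map_mul hv_mul]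
  | succ n ih =>
    rw [pow_succ, hv_mul _ _ (pow_ne_zero n hx) hx, ih]
    push_cast
    ring

theorem map_div_of_map_mul (hv_mul : ∀ x y : L, x ≠ 0 → y ≠ 0 → v (x * y) = v x + v y)
    {x y : L} (hx : x ≠ 0) (hy : y ≠ 0) : v (x / y) = v x - v y := by
  have := hv_mul (x / y) y (div_ne_zero hx hy) hy
  rw [div_mul_cancel₀ _ hy] at this
  linarith

theorem map_inv_of_map_mul (hv_mul : ∀ x y : L, x ≠ 0 → y ≠ 0 → v (x * y) = v x + v y)
    {x : L} (hx : x ≠ 0) : v x⁻¹ = - v x := by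
  have := map_div_of_map_mul hv_mul one_ne_zero hx
  rw [one_div, map_one_eq_zero_of_map_mul hv_mul] at this
  linarith

theorem exists_algebraMap_eq_of_nonneg
    (hv_mul : ∀ x y : L, x ≠ 0 → y ≠ 0 → v (x * y) = v x + v y)
    (hv_p : v ((p : ℕ) : L) = 1) (hv_int : ∀ x : C, x ≠ 0 → 0 ≤ v (algebraMap C L x))
    {x : L} (hx : x ≠ 0) (hvx : 0 ≤ v x) : ∃ c : C, algebraMap C L c = x := by
  rw [← IsIntegralClosure.isIntegral_iff (R := ℤ_[p])]
  by_contra hni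
  have hcast : (p : L) ≠ 0 := by
    have : CharZero L :=
      charZero_of_injective_algebraMap (FaithfulSMul.algebraMap_injective ℚ_[p] L)
    exact_mod_cast (Fact.out : p.Prime).ne_zero
  have hnonneg : ∀ y : L, y ≠ 0 → IsIntegral ℤ_[p] y → 0 ≤ v y := by
    intro y hy hint
    obtain ⟨c, rfl⟩ := (IsIntegralClosure.isIntegral_iff (A := C)).mp hint
    exact hv_int c (by rintro rfl; simp at hy)
  have hinv := hnonneg _ (inv_ne_zero hx) ((isIntegral_padicInt_or_inv x).resolve_left hni)
  rw [map_inv_of_map_mul hv_mul hx] at hinv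
  obtain ⟨n, hn⟩ := exists_isIntegral_pow_div hni
  have hpow := pow_ne_zero n (inv_ne_zero hx)
  have h := hnonneg _ (div_ne_zero hpow hcast) hn
  rw [map_div_of_map_mul hv_mul hpow hcast, map_pow_of_map_mul hv_mul (inv_ne_zero hx),
    map_inv_of_map_mul hv_mul hx, hv_p, show v x = 0 by linarith] at h
  norm_num at h

theorem dvd_iff_map_le (hv_mul : ∀ x y : L, x ≠ 0 → y ≠ 0 → v (x * y) = v x + v y)
    (hv_p : v ((p : ℕ) : L) = 1) (hv_int : ∀ x : C, x ≠ 0 → 0 ≤ v (algebraMap C L x))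
    {a b : C} (ha : a ≠ 0) (hb : b ≠ 0) :
    a ∣ b ↔ v (algebraMap C L a) ≤ v (algebraMap C L b) := by
  have hinj := IsIntegralClosure.algebraMap_injective C ℤ_[p] L
  have ha' : algebraMap C L a ≠ 0 := (map_ne_zero_iff _ hinj).mpr ha
  have hb' : algebraMap C L b ≠ 0 := (map_ne_zero_iff _ hinj).mpr hb
  constructor
  · rintro ⟨c, rfl⟩
    have hc : c ≠ 0 := by rintro rfl; simp at hb
    rw [map_mul, hv_mul _ _ ha' ((map_ne_zero_iff _ hinj).mpr hc)]
    linarith [hv_int c hc]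
  · intro h
    obtain ⟨c, hc⟩ := exists_algebraMap_eq_of_nonneg hv_mul hv_p hv_int (div_ne_zero hb' ha')
      (by rw [map_div_of_map_mul hv_mul hb' ha']; linarith)
    refine ⟨c, hinj ?_⟩
    rw [map_mul, hc, mul_div_cancel₀ _ ha']

theorem map_eq_of_associated (hv_mul : ∀ x y : L, x ≠ 0 → y ≠ 0 → v (x * y) = v x + v y)
    (hv_p : v ((p : ℕ) : L) = 1) (hv_int : ∀ x : C, x ≠ 0 → 0 ≤ v (algebraMap C L x))
    {a b : C} (ha : a ≠ 0) (hab : Associated a b) :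
    v (algebraMap C L a) = v (algebraMap C L b) := by
  have hb : b ≠ 0 := by
    rintro rfl
    exact ha ((associated_zero_iff_eq_zero a).mp hab)
  exact le_antisymm ((dvd_iff_map_le hv_mul hv_p hv_int ha hb).mp hab.dvd)
    ((dvd_iff_map_le hv_mul hv_p hv_int hb ha).mp hab.symm.dvd)

theorem map_sub_one_of_isPrimitiveRoot
    (hv_mul : ∀ x y : L, x ≠ 0 → y ≠ 0 → v (x * y) = v x + v y)
    (hv_p : v ((p : ℕ) : L) = 1) (hv_int : ∀ x : C, x ≠ 0 → 0 ≤ v (algebraMap C L x))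
    {ζ : C} (hζ : IsPrimitiveRoot ζ p) : v (algebraMap C L (ζ - 1)) = 1 / ((p : ℚ) - 1) := by
  have hinj := IsIntegralClosure.algebraMap_injective C ℤ_[p] L
  have : IsDomain C := hinj.isDomain
  have hp : 1 < p := (Fact.out : p.Prime).one_lt
  have hne : ζ - 1 ≠ 0 := sub_ne_zero.mpr (hζ.ne_one hp)
  have hne' := (map_ne_zero_iff _ hinj).mpr hne
  have h := map_eq_of_associated hv_mul hv_p hv_int (pow_ne_zero _ hne)
    hζ.associated_sub_one_pow_prime
  rw [map_pow, map_pow_of_map_mul hv_mul hne', map_natCast, hv_p, Nat.cast_sub hp.le,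
    Nat.cast_one] at h
  have hp' : (1 : ℚ) < p := by exact_mod_cast hp
  rw [eq_div_iff (by linarith)]
  linarith

variable [Algebra ℤ_[p] C] [IsScalarTower ℤ_[p] C L]

open Polynomial in
theorem map_aeval_derivative_minpoly
    (hv_mul : ∀ x y : L, x ≠ 0 → y ≠ 0 → v (x * y) = v x + v y)
    (hv_p : v ((p : ℕ) : L) = 1) (hv_int : ∀ x : C, x ≠ 0 → 0 ≤ v (algebraMap C L x))
    {ζ : C} {k : ℕ} (hζ : IsPrimitiveRoot ζ (p ^ (k + 1))) :
    aeval ζ (derivative (minpoly ℤ_[p] ζ)) ≠ 0 ∧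
      v (algebraMap C L (aeval ζ (derivative (minpoly ℤ_[p] ζ)))) =
        ((k + 1 : ℕ) : ℚ) - 1 / ((p : ℚ) - 1) := by
  have hinj := IsIntegralClosure.algebraMap_injective C ℤ_[p] L
  have : IsDomain C := hinj.isDomain
  have hp : p.Prime := Fact.out
  have hL : CharZero L :=
    charZero_of_injective_algebraMap (FaithfulSMul.algebraMap_injective ℚ_[p] L)
  have : CharZero C := ⟨fun m n h ↦ by
    have := congrArg (algebraMap C L) h
    simpa using this⟩
  have hinj' : Function.Injective (algebraMap ℤ_[p] C) := by
    refine Function.Injective.of_comp (f := algebraMap C L) ?_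
    rw [← RingHom.coe_comp, ← IsScalarTower.algebraMap_eq, IsScalarTower.algebraMap_eq ℤ_[p] ℚ_[p] L]
    exact (FaithfulSMul.algebraMap_injective ℚ_[p] L).comp (IsFractionRing.injective ℤ_[p] ℚ_[p])
  have : Module.IsTorsionFree ℤ_[p] C := by
    have : FaithfulSMul ℤ_[p] C := (faithfulSMul_iff_algebraMap_injective _ _).mpr hinj'
    infer_instance
  have hmul := aeval_derivative_minpoly_padicInt_mul hζ
  have hprim : IsPrimitiveRoot (ζ ^ p ^ k) p := hζ.pow (pow_pos hp.pos _) (pow_succ _ _)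
  have hpC : (p : C) ≠ 0 := by exact_mod_cast hp.ne_zero
  have hunit : IsUnit (ζ ^ (p ^ (k + 1) - 1)) := (hζ.isUnit (pow_pos hp.pos _).ne').pow _
  have hrhs : (p : C) ^ (k + 1) * ζ ^ (p ^ (k + 1) - 1) ≠ 0 :=
    mul_ne_zero (pow_ne_zero _ hpC) hunit.ne_zero
  have hne : aeval ζ (derivative (minpoly ℤ_[p] ζ)) ≠ 0 := fun h ↦ by
    rw [h, zero_mul] at hmul
    exact hrhs hmul.symm
  refine ⟨hne, ?_⟩
  have hne2 : ζ ^ p ^ k - 1 ≠ 0 := sub_ne_zero.mpr (hprim.ne_one hp.one_lt)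
  have h := map_eq_of_associated hv_mul hv_p hv_int (pow_ne_zero (k + 1) hpC)
    (associated_mul_unit_right _ _ hunit)
  rw [← hmul, map_mul, hv_mul _ _ ((map_ne_zero_iff _ hinj).mpr hne)
    ((map_ne_zero_iff _ hinj).mpr hne2), map_sub_one_of_isPrimitiveRoot hv_mul hv_p hv_int hprim,
    map_pow, map_natCast, map_pow_of_map_mul hv_mul (by exact_mod_cast hp.ne_zero), hv_p] at h
  linarith

end Valuation

theorem valuationRing_of_isIntegralClosure (p : ℕ) [Fact p.Prime] (L C : Type*) [Field L]
    [Algebra ℚ_[p] L] [Algebra ℤ_[p] L] [IsScalarTower ℤ_[p] ℚ_[p] L] [Algebra.IsAlgebraic ℚ_[p] L]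
    [CommRing C] [IsDomain C] [Algebra C L] [IsIntegralClosure C ℤ_[p] L] : ValuationRing C := by
  have hinj : Function.Injective (algebraMap C L) := IsIntegralClosure.algebraMap_injective C ℤ_[p] L
  rw [ValuationRing.iff_dvd_total]
  refine ⟨fun a b ↦ ?_⟩
  by_cases ha : a = 0
  · exact .inr (ha ▸ dvd_zero b)
  by_cases hb : b = 0
  · exact .inl (hb ▸ dvd_zero a)
  have ha' := (map_ne_zero_iff _ hinj).mpr ha
  have hb' := (map_ne_zero_iff _ hinj).mpr hb
  rcases isIntegral_padicInt_or_inv (p := p) (algebraMap C L a / algebraMap C L b) with h | h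
  · obtain ⟨c, hc⟩ := (IsIntegralClosure.isIntegral_iff (A := C)).mp h
    exact .inr ⟨c, hinj (by rw [map_mul, hc, mul_div_cancel₀ _ hb'])⟩
  · obtain ⟨c, hc⟩ := (IsIntegralClosure.isIntegral_iff (A := C)).mp h
    exact .inl ⟨c, hinj (by rw [map_mul, hc, inv_div, mul_div_cancel₀ _ ha'])⟩

/-- Every finite subset of the integral closure `C` of `ℤ_p` in an algebraic extension `L` is
contained in the ring of integers of a finite subextension. -/
theorem exists_subalgebra_isDiscreteValuationRing {p : ℕ} [Fact p.Prime] {B C : Type*}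
    [CommRing B] [Algebra ℤ_[p] B] [CommRing C] [IsDomain C] [Algebra ℤ_[p] C] [Algebra B C]
    [IsScalarTower ℤ_[p] B C] (K L : Type*) [Field K] [Algebra ℚ_[p] K]
    [FiniteDimensional ℚ_[p] K] [Field L] [Algebra K L] [Algebra ℤ_[p] K]
    [IsScalarTower ℤ_[p] ℚ_[p] K] [Algebra ℚ_[p] L] [Algebra ℤ_[p] L] [IsScalarTower ℤ_[p] ℚ_[p] L]
    [IsScalarTower ℚ_[p] K L] [Algebra.IsAlgebraic ℚ_[p] L] [Algebra B K] [IsScalarTower ℤ_[p] B K]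
    [Algebra C L] [IsScalarTower ℤ_[p] C L]
    [IsIntegralClosure C ℤ_[p] L] [Algebra B L] [IsScalarTower B K L]
    [IsScalarTower B C L] {F : Set C} (hF : F.Finite) :
    ∃ S : Subalgebra B C, F ⊆ S ∧ Module.Finite ℤ_[p] S ∧ IsDiscreteValuationRing S ∧
      Module.IsTorsionFree ℤ_[p] S := by
  have : IsScalarTower ℤ_[p] K L := .to₁₃₄ ℤ_[p] ℚ_[p] K L
  have hinj : Function.Injective (algebraMap C L) := IsIntegralClosure.algebraMap_injective C ℤ_[p] L
  let M : IntermediateField K L := IntermediateField.adjoin K (algebraMap C L '' F)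
  have hM : FiniteDimensional K M := by
    have : Finite (algebraMap C L '' F) := hF.image _
    refine IntermediateField.finiteDimensional_adjoin fun x _ ↦ ?_
    have : IsAlgebraic ℚ_[p] x := Algebra.IsAlgebraic.isAlgebraic x
    exact (this.tower_top K).isIntegral
  have : FiniteDimensional ℚ_[p] M := .trans ℚ_[p] K M
  let S : Subalgebra B C := (M.toSubalgebra.restrictScalars B).comap (IsScalarTower.toAlgHom B C L)
  have hmemS : ∀ c : C, c ∈ S ↔ algebraMap C L c ∈ M := fun c ↦ Iff.rfl
  let φ : S →+* M := ((algebraMap C L).comp S.val.toRingHom).codRestrict M fun s ↦ s.2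
  let : Algebra S M := φ.toAlgebra
  have hφ : ∀ s : S, ((algebraMap S M s : M) : L) = algebraMap C L s := fun s ↦ rfl
  have : IsScalarTower ℤ_[p] S M := .of_algebraMap_eq fun x ↦ by
    apply Subtype.ext
    rw [hφ]
    change algebraMap ℤ_[p] L x = algebraMap C L (algebraMap ℤ_[p] C x)
    rw [← IsScalarTower.algebraMap_apply]
  have : IsScalarTower ℤ_[p] ℚ_[p] M := .of_algebraMap_eq fun x ↦ by
    apply Subtype.ext
    change algebraMap ℤ_[p] L x = algebraMap ℚ_[p] L (algebraMap ℤ_[p] ℚ_[p] x)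
    rw [← IsScalarTower.algebraMap_apply]
  have hIC : IsIntegralClosure S ℤ_[p] M :=
    { algebraMap_injective := fun s t h ↦ Subtype.ext (hinj (congrArg (Subtype.val : M → L) h))
      isIntegral_iff := fun {x} ↦ by
        have hx : IsIntegral ℤ_[p] x ↔ IsIntegral ℤ_[p] (x : L) :=
          (isIntegral_algHom_iff (M.val.restrictScalars ℤ_[p]) Subtype.val_injective).symm
        rw [hx, IsIntegralClosure.isIntegral_iff (A := C)]
        constructor
        · rintro ⟨c, hc⟩
          exact ⟨⟨c, (hmemS c).mpr (hc ▸ x.2)⟩, Subtype.ext hc⟩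
        · rintro ⟨s, rfl⟩
          exact ⟨s, rfl⟩ }
  have hfin : Module.Finite ℤ_[p] S := IsIntegralClosure.finite ℤ_[p] ℚ_[p] M S
  have : IsDedekindDomain S := IsIntegralClosure.isDedekindDomain ℤ_[p] ℚ_[p] M S
  have : Module.IsTorsionFree ℤ_[p] M := Module.IsTorsionFree.trans_faithfulSMul ℤ_[p] ℚ_[p] M
  have htf : Module.IsTorsionFree ℤ_[p] S := IsIntegralClosure.isTorsionFree ℤ_[p] M
  have hdvd : ∀ a b : S, (a : C) ∣ b → a ∣ b := by
    rintro a b ⟨c, hc⟩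
    by_cases ha : a = 0
    · subst ha
      refine ⟨0, Subtype.ext ?_⟩
      simpa using hc
    · have hcS : c ∈ S := by
        rw [hmemS]
        have ha' : algebraMap C L a ≠ 0 := (map_ne_zero_iff _ hinj).mpr (by simpa using ha)
        have : algebraMap C L c = algebraMap C L b / algebraMap C L a := by
          rw [hc, map_mul, mul_div_cancel_left₀ _ ha']
        rw [this]
        exact div_mem b.2 a.2
      exact ⟨⟨c, hcS⟩, Subtype.ext hc⟩
  have : ValuationRing S := by
    rw [ValuationRing.iff_dvd_total]
    have := valuationRing_of_isIntegralClosure p L C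
    exact ⟨fun a b ↦ (ValuationRing.dvd_total (a : C) b).imp (hdvd a b) (hdvd b a)⟩
  have : IsDiscreteValuationRing S := by
    have hnf : ¬ IsField S := by
      have : FaithfulSMul ℤ_[p] S := inferInstance
      rw [← Algebra.IsIntegral.isField_iff_isField (R := ℤ_[p])
        (FaithfulSMul.algebraMap_injective ℤ_[p] S)]
      exact IsDiscreteValuationRing.not_isField ℤ_[p]
    have h := (IsDiscreteValuationRing.TFAE S hnf).out 0 1
    exact h.mpr inferInstance
  refine ⟨S, fun x hx ↦ ?_, hfin, this, htf⟩
  exact IntermediateField.subset_adjoin K _ ⟨x, hx, rfl⟩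

/-- The map `(S →₀ S) → (C →₀ C)` induced by the inclusion of a subalgebra. -/
noncomputable def Subalgebra.finsuppMap {B C : Type*} [CommRing B] [CommRing C] [Algebra B C]
    (S : Subalgebra B C) : (S →₀ S) →+ (C →₀ C) :=
  (Finsupp.mapDomain.addMonoidHom ((↑) : S → C)).comp
    (Finsupp.mapRange.addMonoidHom (S.val : S →+ C))

theorem Subalgebra.finsuppMap_single {B C : Type*} [CommRing B] [CommRing C] [Algebra B C]
    (S : Subalgebra B C) (a b : S) :
    S.finsuppMap (Finsupp.single a b) = Finsupp.single (a : C) (b : C) := by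
  simp [finsuppMap]

theorem Subalgebra.finsuppMap_smul {B C : Type*} [CommRing B] [CommRing C] [Algebra B C]
    (S : Subalgebra B C) (s : S) (y : S →₀ S) :
    S.finsuppMap (s • y) = (s : C) • S.finsuppMap y := by
  induction y using Finsupp.induction_linear with
  | zero => simp
  | add f g hf hg => rw [smul_add, map_add, hf, hg, map_add, smul_add]
  | single a b =>
    rw [Finsupp.smul_single, finsuppMap_single, finsuppMap_single, Finsupp.smul_single]
    rfl

theorem Subalgebra.finsuppMap_injective {B C : Type*} [CommRing B] [CommRing C] [Algebra B C]
    (S : Subalgebra B C) : Function.Injective S.finsuppMap :=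
  (Finsupp.mapDomain_injective Subtype.val_injective).comp
    (Finsupp.mapRange_injective _ (map_zero _) Subtype.val_injective)

theorem exists_finite_of_mem_kerTotal {B C : Type*} [CommRing B] [CommRing C] [Algebra B C]
    {x : C →₀ C} (hx : x ∈ KaehlerDifferential.kerTotal B C) :
    ∃ F : Set C, F.Finite ∧ ∀ S : Subalgebra B C, F ⊆ S →
      ∃ y ∈ KaehlerDifferential.kerTotal B S, S.finsuppMap y = x := by
  rw [KaehlerDifferential.kerTotal] at hx
  induction hx using Submodule.span_induction with
  | zero => exact ⟨∅, Set.finite_empty, fun S _ ↦ ⟨0, zero_mem _, map_zero _⟩⟩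
  | add x y _ _ hx hy =>
    obtain ⟨F, hF, hFS⟩ := hx
    obtain ⟨G, hG, hGS⟩ := hy
    refine ⟨F ∪ G, hF.union hG, fun S hS ↦ ?_⟩
    obtain ⟨x', hx', hxx'⟩ := hFS S (Set.subset_union_left.trans hS)
    obtain ⟨y', hy', hyy'⟩ := hGS S (Set.subset_union_right.trans hS)
    exact ⟨x' + y', add_mem hx' hy', by rw [map_add, hxx', hyy']⟩
  | smul c x _ hx =>
    obtain ⟨F, hF, hFS⟩ := hx
    refine ⟨insert c F, hF.insert c, fun S hS ↦ ?_⟩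
    obtain ⟨x', hx', hxx'⟩ := hFS S ((Set.subset_insert _ _).trans hS)
    exact ⟨(⟨c, hS (Set.mem_insert _ _)⟩ : S) • x', Submodule.smul_mem _ _ hx', by
      rw [S.finsuppMap_smul, hxx']⟩
  | mem x hx =>
    rcases hx with (⟨⟨a, b⟩, rfl⟩ | ⟨⟨a, b⟩, rfl⟩) | ⟨b, rfl⟩
    · refine ⟨{a, b}, by simp, fun S hS ↦ ?_⟩
      have ha : a ∈ S := hS (by simp)
      have hb : b ∈ S := hS (by simp)
      refine ⟨_, Submodule.subset_span (.inl (.inl ⟨(⟨a, ha⟩, ⟨b, hb⟩), rfl⟩)), ?_⟩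
      simp [map_sub, Subalgebra.finsuppMap_single]
    · refine ⟨{a, b}, by simp, fun S hS ↦ ?_⟩
      have ha : a ∈ S := hS (by simp)
      have hb : b ∈ S := hS (by simp)
      refine ⟨_, Submodule.subset_span (.inl (.inr ⟨(⟨a, ha⟩, ⟨b, hb⟩), rfl⟩)), ?_⟩
      simp [map_sub, Subalgebra.finsuppMap_single]
    · refine ⟨∅, Set.finite_empty, fun S _ ↦ ?_⟩
      refine ⟨_, Submodule.subset_span (.inr ⟨b, rfl⟩), ?_⟩
      simp [Subalgebra.finsuppMap_single]

/-- A relation `a • dz = 0` already holds over all sufficiently large subalgebras. -/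
theorem exists_finite_of_smul_D_eq_zero {B C : Type*} [CommRing B] [CommRing C] [Algebra B C]
    {a z : C} (h : a • KaehlerDifferential.D B C z = 0) :
    ∃ F : Set C, F.Finite ∧ ∀ S : Subalgebra B C, F ⊆ S → ∀ a' z' : S, (a' : C) = a → (z' : C) = z →
      a' • KaehlerDifferential.D B S z' = 0 := by
  have hx : Finsupp.single z a ∈ KaehlerDifferential.kerTotal B C := by
    rw [← KaehlerDifferential.kerTotal_eq, LinearMap.mem_ker, Finsupp.linearCombination_single, h]
  obtain ⟨F, hF, hFS⟩ := exists_finite_of_mem_kerTotal hx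
  refine ⟨F, hF, fun S hS a' z' ha hz ↦ ?_⟩
  obtain ⟨y, hy, hyx⟩ := hFS S hS
  have : y = Finsupp.single z' a' := S.finsuppMap_injective (by
    rw [hyx, S.finsuppMap_single, ha, hz])
  rwa [this, ← KaehlerDifferential.kerTotal_eq, LinearMap.mem_ker,
    Finsupp.linearCombination_single] at hy

theorem KaehlerDifferential.smul_D_eq_zero_of_subalgebra {B C : Type*} [CommRing B] [CommRing C]
    [Algebra B C] {S : Subalgebra B C} {a z : S} (h : a • KaehlerDifferential.D B S z = 0) :
    (a : C) • KaehlerDifferential.D B C z = 0 := by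
  have := congrArg (KaehlerDifferential.map B B S C) h
  rwa [map_smul, KaehlerDifferential.map_D, map_zero, algebra_compatible_smul C] at this

open Polynomial in
theorem smul_D_eq_zero_iff_of_subalgebra {p : ℕ} [Fact p.Prime] {B C : Type*}
    [CommRing B] [IsDedekindDomain B] [Algebra ℤ_[p] B] [Module.Finite ℤ_[p] B]
    [Module.IsTorsionFree ℤ_[p] B] [CommRing C] [IsDomain C] [CharZero C] [Algebra ℤ_[p] C]
    [Algebra B C] [IsScalarTower ℤ_[p] B C] [FaithfulSMul B C] [FaithfulSMul ℤ_[p] C]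
    {d : B} (hd : differentIdeal ℤ_[p] B = Ideal.span {d}) {ζ : C} {k : ℕ}
    (hζ : IsPrimitiveRoot ζ (p ^ (k + 1))) (S : Subalgebra B C) [Module.Finite ℤ_[p] S]
    [IsDiscreteValuationRing S] [Module.IsTorsionFree ℤ_[p] S] {a z : S} (hz : (z : C) = ζ) :
    a • KaehlerDifferential.D B S z = 0 ↔
      ∃ c : S, (c : C) * aeval ζ (derivative (minpoly ℤ_[p] ζ)) = a * algebraMap B C d := by
  have hp : p.Prime := Fact.out
  obtain ⟨γ, hγ⟩ := exists_adjoin_eq_top_of_isDiscreteValuationRing ℤ_[p] S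
  obtain ⟨R, hR⟩ : ∃ R : Subalgebra ℤ_[p] C, R = Algebra.adjoin ℤ_[p] {ζ} := ⟨_, rfl⟩
  have hint : IsIntegral ℤ_[p] ζ := (hζ.isIntegral (pow_pos hp.pos _)).tower_top
  have hRS : R ≤ S.restrictScalars ℤ_[p] :=
    hR ▸ Algebra.adjoin_le (Set.singleton_subset_iff.mpr (hz ▸ z.2))
  let φ : R →+* S := R.val.toRingHom.codRestrict S fun r ↦ hRS r.2
  let : Algebra R S := φ.toAlgebra
  have hφ : ∀ r : R, ((algebraMap R S r : S) : C) = r := fun _ ↦ rfl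
  have : IsScalarTower ℤ_[p] R S := .of_algebraMap_eq fun x ↦ Subtype.ext rfl
  have : Module.Finite ℤ_[p] R :=
    Module.Finite.iff_fg.mpr <| hR ▸ hint.fg_adjoin_singleton
  let ζ' : R := ⟨ζ, hR ▸ Algebra.self_mem_adjoin_singleton _ _⟩
  have hζ' : IsPrimitiveRoot ζ' (p ^ (k + 1)) :=
    IsPrimitiveRoot.of_map_of_injective (f := R.val) hζ Subtype.val_injective
  have hadj : Algebra.adjoin ℤ_[p] {ζ'} = ⊤ := by
    subst hR
    have := Algebra.adjoin_adjoin_coe_preimage (R := ℤ_[p]) (s := {ζ})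
    rw [← this]
    congr 1
    ext x
    simp [ζ', Subtype.ext_iff]
  have : IsDedekindDomain R := isDedekindDomain_of_adjoin_eq_top hζ' hadj
  have : FaithfulSMul R S := (faithfulSMul_iff_algebraMap_injective _ _).mpr fun x y h ↦
    Subtype.ext (congrArg (Subtype.val : S → C) h)
  have : FaithfulSMul B S := (faithfulSMul_iff_algebraMap_injective _ _).mpr fun x y h ↦
    FaithfulSMul.algebraMap_injective B C (congrArg (Subtype.val : S → C) h)
  have : Module.IsTorsionFree R S := FaithfulSMul.to_isTorsionFree R S
  have hzζ : algebraMap R S ζ' = z := Subtype.ext (by rw [hφ, hz])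
  have key := smul_D_algebraMap_eq_zero_iff hγ hadj hd a
  have hmin : minpoly ℤ_[p] ζ = minpoly ℤ_[p] ζ' :=
    minpoly.algebraMap_eq (B' := C) (Subtype.val_injective : Function.Injective (algebraMap R C)) ζ'
  have haev : aeval ζ (derivative (minpoly ℤ_[p] ζ)) =
      ((algebraMap R S (aeval ζ' (derivative (minpoly ℤ_[p] ζ'))) : S) : C) := by
    rw [hφ, hmin]
    exact aeval_algebraMap_apply C ζ' _
  rw [hzζ] at key
  rw [key, haev]
  constructor
  · rintro ⟨c, hc⟩
    refine ⟨c, ?_⟩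
    have := congrArg (Subtype.val : S → C) hc
    rw [mul_comm]
    exact this.symm
  · rintro ⟨c, hc⟩
    refine ⟨c, Subtype.ext ?_⟩
    rw [mul_comm] at hc
    exact hc.symm

open Polynomial in
/-- For a primitive `p ^ (k + 1)`-th root of unity `ζ` in the integral closure `C` of `ℤ_p` in an
algebraic extension, the annihilator of `dζ` in `Ω¹_{C/B}` is `{a | f'(ζ) ∣ a d}`, where `f` is the
minimal polynomial of `ζ` and `d` generates the different of `B`. -/
theorem smul_D_eq_zero_iff_dvd {p : ℕ} [Fact p.Prime] {B C : Type*}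
    [CommRing B] [IsDedekindDomain B] [Algebra ℤ_[p] B] [Module.Finite ℤ_[p] B]
    [Module.IsTorsionFree ℤ_[p] B] [CommRing C] [IsDomain C] [CharZero C] [Algebra ℤ_[p] C]
    [Algebra B C] [IsScalarTower ℤ_[p] B C] [FaithfulSMul B C] [FaithfulSMul ℤ_[p] C]
    (hlevel : ∀ F : Set C, F.Finite → ∃ S : Subalgebra B C, F ⊆ S ∧ Module.Finite ℤ_[p] S ∧
      IsDiscreteValuationRing S ∧ Module.IsTorsionFree ℤ_[p] S)
    {d : B} (hd : differentIdeal ℤ_[p] B = Ideal.span {d}) {ζ : C} {k : ℕ}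
    (hζ : IsPrimitiveRoot ζ (p ^ (k + 1))) (a : C) :
    a • KaehlerDifferential.D B C ζ = 0 ↔
      aeval ζ (derivative (minpoly ℤ_[p] ζ)) ∣ a * algebraMap B C d := by
  constructor
  · intro h
    obtain ⟨F, hF, hFS⟩ := exists_finite_of_smul_D_eq_zero h
    obtain ⟨S, hS, _, _, _⟩ := hlevel (F ∪ {a, ζ}) (hF.union (by simp))
    have ha : a ∈ S := hS (by simp)
    have hz : ζ ∈ S := hS (by simp)
    obtain ⟨c, hc⟩ := (smul_D_eq_zero_iff_of_subalgebra hd hζ S (a := ⟨a, ha⟩) (z := ⟨ζ, hz⟩) rfl).mp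
      (hFS S (Set.subset_union_left.trans hS) _ _ rfl rfl)
    exact ⟨c, by rw [mul_comm _ (c : C), hc]⟩
  · rintro ⟨c, hc⟩
    obtain ⟨S, hS, _, _, _⟩ := hlevel {a, ζ, c} (by simp)
    have ha : a ∈ S := hS (by simp)
    have hz : ζ ∈ S := hS (by simp)
    have hcS : c ∈ S := hS (by simp)
    have h := (smul_D_eq_zero_iff_of_subalgebra hd hζ S (a := ⟨a, ha⟩) (z := ⟨ζ, hz⟩) rfl).mpr
      ⟨⟨c, hcS⟩, by rw [hc, mul_comm]⟩
    have h' := KaehlerDifferential.smul_D_eq_zero_of_subalgebra h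
    exact h'

open Polynomial in
theorem aeval_derivative_minpoly_ne_zero {A S : Type*} [CommRing A] [IsDomain A]
    [IsIntegrallyClosed A] [CharZero A] [CommRing S] [IsDomain S] [Algebra A S]
    [Module.IsTorsionFree A S] {γ : S} (hint : IsIntegral A γ) :
    aeval γ (derivative (minpoly A γ)) ≠ 0 := by
  intro h
  have hne : derivative (minpoly A γ) ≠ 0 := fun h0 ↦
    (minpoly.natDegree_pos hint).ne' (derivative_eq_zero.mp h0)
  exact absurd (minpoly.IsIntegrallyClosed.degree_le_of_ne_zero hne h)
    (not_le.mpr (degree_derivative_lt (minpoly.ne_zero hint)))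

open Polynomial in
theorem exists_finite_mem_span_D (A : Type*) {B C : Type*} [CommRing A] [CommRing B] [CommRing C]
    [Algebra A B] [Algebra A C] [Algebra B C] [IsScalarTower A B C]
    (ω : KaehlerDifferential B C) :
    ∃ F : Set C, F.Finite ∧ ∀ γ : C, F ⊆ Algebra.adjoin A {γ} →
      ∃ c : C, ω = c • KaehlerDifferential.D B C γ := by
  have hω : ω ∈ Submodule.span C (Set.range (KaehlerDifferential.D B C)) := by
    rw [KaehlerDifferential.span_range_derivation]
    exact Submodule.mem_top
  induction hω using Submodule.span_induction with
  | zero => exact ⟨∅, Set.finite_empty, fun γ _ ↦ ⟨0, (zero_smul C _).symm⟩⟩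
  | add x y _ _ hx hy =>
    obtain ⟨F, hF, hFγ⟩ := hx
    obtain ⟨G, hG, hGγ⟩ := hy
    refine ⟨F ∪ G, hF.union hG, fun γ hγ ↦ ?_⟩
    obtain ⟨c, rfl⟩ := hFγ γ (Set.subset_union_left.trans hγ)
    obtain ⟨e, rfl⟩ := hGγ γ (Set.subset_union_right.trans hγ)
    exact ⟨c + e, (add_smul _ _ _).symm⟩
  | smul a x _ hx =>
    obtain ⟨F, hF, hFγ⟩ := hx
    refine ⟨F, hF, fun γ hγ ↦ ?_⟩
    obtain ⟨c, rfl⟩ := hFγ γ hγ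
    exact ⟨a * c, smul_smul _ _ _⟩
  | mem x hx =>
    obtain ⟨z, rfl⟩ := hx
    refine ⟨{z}, Set.finite_singleton z, fun γ hγ ↦ ?_⟩
    have hz : z ∈ Algebra.adjoin A {γ} := hγ rfl
    rw [Algebra.adjoin_singleton_eq_range_aeval] at hz
    obtain ⟨g, rfl⟩ := hz
    exact ⟨_, D_aeval_eq_smul_D γ g⟩

/-- Finitely many differentials on the integral closure of `ℤ_p` in an algebraic extension are
multiples of a single torsion differential `dγ`. -/
theorem exists_D_eq_smul {p : ℕ} [Fact p.Prime] {B C : Type*}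
    [CommRing B] [Algebra ℤ_[p] B] [CommRing C] [IsDomain C] [Algebra ℤ_[p] C]
    [Algebra B C] [IsScalarTower ℤ_[p] B C] [FaithfulSMul ℤ_[p] C] [Algebra.IsIntegral ℤ_[p] C]
    (hlevel : ∀ F : Set C, F.Finite → ∃ S : Subalgebra B C, F ⊆ S ∧ Module.Finite ℤ_[p] S ∧
      IsDiscreteValuationRing S ∧ Module.IsTorsionFree ℤ_[p] S)
    (ω η : KaehlerDifferential B C) :
    ∃ γ c e : C, ω = c • KaehlerDifferential.D B C γ ∧ η = e • KaehlerDifferential.D B C γ ∧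
      ∃ t : C, t ≠ 0 ∧ t • KaehlerDifferential.D B C γ = 0 := by
  obtain ⟨F, hF, hFγ⟩ := exists_finite_mem_span_D ℤ_[p] ω
  obtain ⟨G, hG, hGγ⟩ := exists_finite_mem_span_D ℤ_[p] η
  obtain ⟨S, hS, _, _, _⟩ := hlevel (F ∪ G) (hF.union hG)
  obtain ⟨γ, hγ⟩ := exists_adjoin_eq_top_of_isDiscreteValuationRing ℤ_[p] S
  have hSγ : (S : Set C) ⊆ Algebra.adjoin ℤ_[p] {(γ : C)} := by
    intro x hx
    have hmem : (⟨x, hx⟩ : S) ∈ Algebra.adjoin ℤ_[p] {γ} := hγ ▸ Algebra.mem_top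
    have := (Subalgebra.mem_map (f := S.val.restrictScalars ℤ_[p])).mpr ⟨_, hmem, rfl⟩
    rw [AlgHom.map_adjoin_singleton] at this
    exact this
  obtain ⟨c, hc⟩ := hFγ γ (Set.subset_union_left.trans (hS.trans hSγ))
  obtain ⟨e, he⟩ := hGγ γ (Set.subset_union_right.trans (hS.trans hSγ))
  refine ⟨γ, c, e, hc, he, _,
    aeval_derivative_minpoly_ne_zero (Algebra.IsIntegral.isIntegral (R := ℤ_[p]) (γ : C)), ?_⟩
  rw [← D_aeval_eq_smul_D, minpoly.aeval, map_zero]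

/-- A `p`-divisible sequence `w r = q • w (r + 1)` in a module extends to an additive map on the
localization at `q`, sending `a / q ^ r` to `a • w r`. -/
theorem exists_addMonoidHom_div_pow {C L M : Type*} [CommRing C] [Field L] [Algebra C L]
    [AddCommGroup M] [Module C M] (hinj : Function.Injective (algebraMap C L)) {q : C} (hq : q ≠ 0)
    (hdiv : ∀ x : L, ∃ (a : C) (r : ℕ), x = algebraMap C L a / algebraMap C L q ^ r)
    {w : ℕ → M} (hw : ∀ r, w r = q • w (r + 1)) :
    ∃ ψ : L →+ M, ∀ (a : C) (r : ℕ), ψ (algebraMap C L a / algebraMap C L q ^ r) = a • w r := by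
  have hq' : algebraMap C L q ≠ 0 := (map_ne_zero_iff _ hinj).mpr hq
  have hw' : ∀ r s, w r = q ^ s • w (r + s) := by
    intro r s
    induction s with
    | zero => simp
    | succ s ih => rw [ih, hw (r + s), smul_smul, ← pow_succ, add_assoc]
  have hwd : ∀ (a b : C) (r s : ℕ), algebraMap C L a / algebraMap C L q ^ r =
      algebraMap C L b / algebraMap C L q ^ s → a • w r = b • w s := by
    intro a b r s h
    rw [div_eq_div_iff (pow_ne_zero _ hq') (pow_ne_zero _ hq')] at h
    have h' : a * q ^ s = b * q ^ r := hinj (by simpa using h)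
    rw [hw' r s, hw' s r, smul_smul, smul_smul, h', add_comm]
  choose num den hnd using hdiv
  refine ⟨AddMonoidHom.mk' (fun x ↦ num x • w (den x)) fun x y ↦ ?_, fun a r ↦ ?_⟩
  · have h : num (x + y) • w (den (x + y)) =
        (num x * q ^ den y + num y * q ^ den x) • w (den x + den y) := by
      refine hwd _ _ _ _ ?_
      rw [← hnd]
      nth_rw 1 [hnd x, hnd y]
      rw [map_add, map_mul, map_mul, map_pow, map_pow, div_add_div _ _ (pow_ne_zero _ hq')
        (pow_ne_zero _ hq'), pow_add, mul_comm (algebraMap C L (num y))]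
    rw [h, add_smul, mul_smul, mul_smul, ← hw', add_comm (den x), ← hw']
  · exact hwd _ _ _ _ (hnd _).symm

open Polynomial in
theorem smul_D_eq_zero_iff_map_le {p : ℕ} [Fact p.Prime] {L : Type*} [Field L]
    [Algebra ℚ_[p] L] [Algebra ℤ_[p] L] [IsScalarTower ℤ_[p] ℚ_[p] L] [Algebra.IsAlgebraic ℚ_[p] L]
    {B C : Type*} [CommRing B] [IsDedekindDomain B] [Algebra ℤ_[p] B] [Module.Finite ℤ_[p] B]
    [Module.IsTorsionFree ℤ_[p] B] [CommRing C] [IsDomain C] [CharZero C] [Algebra ℤ_[p] C]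
    [Algebra B C] [IsScalarTower ℤ_[p] B C] [FaithfulSMul B C] [FaithfulSMul ℤ_[p] C]
    [Algebra C L] [IsIntegralClosure C ℤ_[p] L] [IsScalarTower ℤ_[p] C L]
    (hlevel : ∀ F : Set C, F.Finite → ∃ S : Subalgebra B C, F ⊆ S ∧ Module.Finite ℤ_[p] S ∧
      IsDiscreteValuationRing S ∧ Module.IsTorsionFree ℤ_[p] S) {v : L → ℚ}
    (hv_mul : ∀ x y : L, x ≠ 0 → y ≠ 0 → v (x * y) = v x + v y)
    (hv_p : v ((p : ℕ) : L) = 1) (hv_int : ∀ x : C, x ≠ 0 → 0 ≤ v (algebraMap C L x))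
    {d : B} (hd0 : d ≠ 0) (hd : differentIdeal ℤ_[p] B = Ideal.span {d}) {ζ : C} {k : ℕ}
    (hζ : IsPrimitiveRoot ζ (p ^ (k + 1))) (a : C) :
    a • KaehlerDifferential.D B C ζ = 0 ↔ a = 0 ∨ ((k + 1 : ℕ) : ℚ) -
      v (algebraMap C L (algebraMap B C d)) - 1 / ((p : ℚ) - 1) ≤ v (algebraMap C L a) := by
  have hinj := IsIntegralClosure.algebraMap_injective C ℤ_[p] L
  have hd' : algebraMap B C d ≠ 0 :=
    (map_ne_zero_iff _ (FaithfulSMul.algebraMap_injective B C)).mpr hd0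
  rw [smul_D_eq_zero_iff_dvd hlevel hd hζ]
  rcases eq_or_ne a 0 with rfl | ha
  · simp
  obtain ⟨hne, hv⟩ := map_aeval_derivative_minpoly hv_mul hv_p hv_int hζ
  rw [dvd_iff_map_le hv_mul hv_p hv_int hne (mul_ne_zero ha hd'), hv, map_mul,
    hv_mul _ _ ((map_ne_zero_iff _ hinj).mpr ha) ((map_ne_zero_iff _ hinj).mpr hd')]
  simp only [ha, false_or]
  constructor <;> intro h <;> linarith

/-- Every differential on the integral closure of `ℤ_p` is a multiple of `dζ` for any root of unity
`ζ` of sufficiently large `p`-power order. -/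
theorem exists_forall_eq_smul_D {p : ℕ} [Fact p.Prime] {L : Type*} [Field L]
    [Algebra ℚ_[p] L] [Algebra ℤ_[p] L] [IsScalarTower ℤ_[p] ℚ_[p] L] [Algebra.IsAlgebraic ℚ_[p] L]
    {B C : Type*} [CommRing B] [IsDedekindDomain B] [Algebra ℤ_[p] B] [Module.Finite ℤ_[p] B]
    [Module.IsTorsionFree ℤ_[p] B] [CommRing C] [IsDomain C] [CharZero C] [Algebra ℤ_[p] C]
    [Algebra B C] [IsScalarTower ℤ_[p] B C] [FaithfulSMul B C] [FaithfulSMul ℤ_[p] C]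
    [Algebra C L] [IsIntegralClosure C ℤ_[p] L] [IsScalarTower ℤ_[p] C L]
    (hlevel : ∀ F : Set C, F.Finite → ∃ S : Subalgebra B C, F ⊆ S ∧ Module.Finite ℤ_[p] S ∧
      IsDiscreteValuationRing S ∧ Module.IsTorsionFree ℤ_[p] S) {v : L → ℚ}
    (hv_mul : ∀ x y : L, x ≠ 0 → y ≠ 0 → v (x * y) = v x + v y)
    (hv_p : v ((p : ℕ) : L) = 1) (hv_int : ∀ x : C, x ≠ 0 → 0 ≤ v (algebraMap C L x))
    {d : B} (hd0 : d ≠ 0) (hd : differentIdeal ℤ_[p] B = Ideal.span {d})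
    (ω : KaehlerDifferential B C) :
    ∃ k : ℕ, ∀ ζ : C, IsPrimitiveRoot ζ (p ^ (k + 1)) →
      ∃ a : C, ω = a • KaehlerDifferential.D B C ζ := by
  have : Algebra.IsIntegral ℤ_[p] C := IsIntegralClosure.isIntegral_algebra ℤ_[p] L
  have := valuationRing_of_isIntegralClosure p L C
  obtain ⟨γ₀, c₀, -, hω₀, -, t, ht0, ht⟩ := exists_D_eq_smul hlevel ω 0
  have htω : t • ω = 0 := by rw [hω₀, smul_comm, ht, smul_zero]
  obtain ⟨k, hk⟩ := exists_nat_gt (v (algebraMap C L t) +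
    v (algebraMap C L (algebraMap B C d)) + 1 / ((p : ℚ) - 1))
  refine ⟨k, fun ζ hζ ↦ ?_⟩
  obtain ⟨γ, c, e, hc, he, -⟩ := exists_D_eq_smul hlevel ω (KaehlerDifferential.D B C ζ)
  rcases ValuationRing.dvd_total e c with ⟨s, rfl⟩ | ⟨s, rfl⟩
  · exact ⟨s, by rw [hc, he, smul_smul, mul_comm]⟩
  · have h0 : t • KaehlerDifferential.D B C ζ = 0 := by
      rw [he, mul_comm, mul_smul, ← hc, smul_comm, htω, smul_zero]
    rcases (smul_D_eq_zero_iff_map_le hlevel hv_mul hv_p hv_int hd0 hd hζ t).mp h0 with h | h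
    · exact absurd h ht0
    · push_cast at h
      linarith

theorem pow_sub_one_smul_D_eq_natCast_smul {p : ℕ} (hp : 0 < p) {B C : Type*} [CommRing B]
    [CommRing C] [Algebra B C] (ζ : C) (r : ℕ) :
    (ζ ^ p) ^ (p ^ r - 1) • KaehlerDifferential.D B C (ζ ^ p) =
      (p : C) • ζ ^ (p ^ (r + 1) - 1) • KaehlerDifferential.D B C ζ := by
  have hexp : p * (p ^ r - 1) + (p - 1) = p ^ (r + 1) - 1 := by
    obtain ⟨m, hm⟩ := Nat.exists_eq_succ_of_ne_zero (pow_pos hp r).ne'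
    obtain ⟨n, rfl⟩ := Nat.exists_eq_succ_of_ne_zero hp.ne'
    rw [pow_succ, hm]
    simp only [Nat.succ_eq_add_one, Nat.add_sub_cancel]
    rw [show (m + 1) * (n + 1) = (n + 1) * m + n + 1 by ring, Nat.add_sub_cancel]
  rw [Derivation.leibniz_pow, ← hexp, pow_add, pow_mul, ← Nat.cast_smul_eq_nsmul C]
  simp only [smul_smul]
  ring_nf

theorem IsPrimitiveRoot.eq_pow_sub_one_mul_smul {p r : ℕ} (hp : 0 < p) {C M : Type*} [CommRing C]
    [AddCommGroup M] [Module C M] {ζ : C} (hζ : IsPrimitiveRoot ζ (p ^ r)) (a : C) (m : M) :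
    a • m = (ζ ^ (p ^ r - 1) * (ζ * a)) • m := by
  rw [← mul_assoc, ← pow_succ, Nat.sub_add_cancel (Nat.one_le_pow _ _ hp), hζ.pow_eq_one, one_mul]

/-- **Fontaine's theorem on differentials.**  Let `K` be a finite
extension of `ℚ_p` with ring of integers `O_K`, `K̄` an algebraic closure with ring
of integers `O_K̄`, and `v` the unique valuation of `K̄` extending the `p`-adic
valuation (axiomatized below: multiplicative, ultrametric, `v p = 1`, nonnegative on
integral elements).  Let `d` be a generator of the different `D_{K/ℚ_p}`; since the
maximal unramified subextension `K₀` of `K|ℚ_p` has trivial different over `ℚ_p`,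
`v d = v(D_{K/K₀})`.  Then:
* the `O_K̄`-linear extension of `dlog`, `a ⊗ ζ ↦ a ζ⁻¹ dζ`, is surjective onto
  `Ω¹_{O_K̄/O_K}` (every element is of the form `a ζ⁻¹ dζ = (ζ^{p^r-1} a) • dζ` with
  `ζ` a primitive `p^r`-th root of unity);
* `a ζ⁻¹ dζ = 0` for a primitive `p^r`-th root of unity `ζ` if and only if
  `v a ≥ r - v(D_{K/K₀}) - 1/(p-1)` (or `a = 0`);
* consequently `dlog` induces an isomorphism `(K̄/I_K) ⊗_{ℤ_p} ℤ_p(1) ≅ Ω¹_{O_K̄/O_K}`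
  where `I_K = {a : v a ≥ -v(D_{K/K₀}) - 1/(p-1)}`: after choosing a compatible
  system `(ζ_r)` of primitive `p^r`-th roots of unity (a generator of `ℤ_p(1)`),
  there is an additive isomorphism `K̄/I_K ≃ Ω¹_{O_K̄/O_K}` sending the class of
  `p^{-r} a` (for `a ∈ O_K̄`) to `a ζ_r⁻¹ dζ_r`. -/
theorem fontaine_dlog_surjective_kernel_and_iso
    (p : ℕ) [Fact p.Prime]
    (K : Type*) [Field K] [Algebra ℚ_[p] K] [FiniteDimensional ℚ_[p] K]
    (Kbar : Type*) [Field Kbar] [Algebra K Kbar] [IsAlgClosure K Kbar]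
    [Algebra ℤ_[p] K] [IsScalarTower ℤ_[p] ℚ_[p] K]
    [Algebra ℚ_[p] Kbar] [Algebra ℤ_[p] Kbar]
    [IsScalarTower ℤ_[p] ℚ_[p] Kbar] [IsScalarTower ℚ_[p] K Kbar]
    (OK : Type*) [CommRing OK] [Algebra ℤ_[p] OK] [Algebra OK K]
    [IsScalarTower ℤ_[p] OK K] [IsIntegralClosure OK ℤ_[p] K]
    (OKbar : Type*) [CommRing OKbar] [Algebra ℤ_[p] OKbar] [Algebra OKbar Kbar]
    [IsScalarTower ℤ_[p] OKbar Kbar] [IsIntegralClosure OKbar ℤ_[p] Kbar]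
    [Algebra OK OKbar] [Algebra OK Kbar] [IsScalarTower OK K Kbar]
    [IsScalarTower OK OKbar Kbar]
    [IsDedekindDomain OK] [NoZeroSMulDivisors ℤ_[p] OK]
    (v : Kbar → ℚ)
    (hv_mul : ∀ x y : Kbar, x ≠ 0 → y ≠ 0 → v (x * y) = v x + v y)
    (hv_add : ∀ x y : Kbar, x ≠ 0 → y ≠ 0 → x + y ≠ 0 → min (v x) (v y) ≤ v (x + y))
    (hv_p : v ((p : ℕ) : Kbar) = 1)
    (hv_int : ∀ x : OKbar, x ≠ 0 → 0 ≤ v (algebraMap OKbar Kbar x))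
    (d : OK) (hd : differentIdeal ℤ_[p] OK = Ideal.span {d}) :
    (∀ ω : KaehlerDifferential OK OKbar, ∃ (a ζ : OKbar) (r : ℕ),
        IsPrimitiveRoot ζ (p ^ r) ∧
        ω = (ζ ^ (p ^ r - 1) * a) • KaehlerDifferential.D OK OKbar ζ) ∧
    (∀ (a ζ : OKbar) (r : ℕ), IsPrimitiveRoot ζ (p ^ r) →
        ((ζ ^ (p ^ r - 1) * a) • KaehlerDifferential.D OK OKbar ζ = 0 ↔
          a = 0 ∨ (r : ℚ) - v (algebraMap OK Kbar d) - 1 / ((p : ℚ) - 1) ≤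
            v (algebraMap OKbar Kbar a))) ∧
    (∀ IK : AddSubgroup Kbar,
        (∀ x : Kbar, x ∈ IK ↔
          (x = 0 ∨ -v (algebraMap OK Kbar d) - 1 / ((p : ℚ) - 1) ≤ v x)) →
        ∀ ζ : ℕ → OKbar, (∀ r, IsPrimitiveRoot (ζ r) (p ^ r)) →
          (∀ r, ζ (r + 1) ^ p = ζ r) →
          ∃ e : (Kbar ⧸ IK) ≃+ KaehlerDifferential OK OKbar,
            ∀ (a : OKbar) (r : ℕ),
              e (QuotientAddGroup.mk (algebraMap OKbar Kbar a / (p : Kbar) ^ r)) =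
                (ζ r ^ (p ^ r - 1) * a) • KaehlerDifferential.D OK OKbar (ζ r)) := by
  have hp : p.Prime := Fact.out
  have : Algebra.IsAlgebraic K Kbar := IsAlgClosure.isAlgebraic
  have : Algebra.IsAlgebraic ℚ_[p] Kbar := .trans ℚ_[p] K Kbar
  have : IsAlgClosed Kbar := IsAlgClosure.isAlgClosed K
  have : IsScalarTower ℤ_[p] K Kbar := .to₁₃₄ ℤ_[p] ℚ_[p] K Kbar
  have : CharZero Kbar :=
    charZero_of_injective_algebraMap (FaithfulSMul.algebraMap_injective ℚ_[p] Kbar)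
  have hinj : Function.Injective (algebraMap OKbar Kbar) :=
    IsIntegralClosure.algebraMap_injective OKbar ℤ_[p] Kbar
  have hinjK : Function.Injective (algebraMap OK K) :=
    IsIntegralClosure.algebraMap_injective OK ℤ_[p] K
  have : IsDomain OKbar := hinj.isDomain
  have : CharZero OKbar := ⟨fun m n h ↦ by simpa using congrArg (algebraMap OKbar Kbar) h⟩
  have : IsScalarTower ℤ_[p] OK OKbar := .of_algebraMap_eq fun x ↦ hinj <| by
    rw [← IsScalarTower.algebraMap_apply, ← IsScalarTower.algebraMap_apply,
      IsScalarTower.algebraMap_apply OK K Kbar, ← IsScalarTower.algebraMap_apply ℤ_[p] OK K,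
      ← IsScalarTower.algebraMap_apply]
  have : FaithfulSMul OK OKbar := (faithfulSMul_iff_algebraMap_injective _ _).mpr <| by
    refine Function.Injective.of_comp (f := algebraMap OKbar Kbar) ?_
    rw [← RingHom.coe_comp, ← IsScalarTower.algebraMap_eq, IsScalarTower.algebraMap_eq OK K Kbar]
    exact (algebraMap K Kbar).injective.comp hinjK
  have : FaithfulSMul ℤ_[p] OKbar := (faithfulSMul_iff_algebraMap_injective _ _).mpr <| by
    refine Function.Injective.of_comp (f := algebraMap OKbar Kbar) ?_
    rw [← RingHom.coe_comp, ← IsScalarTower.algebraMap_eq,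
      IsScalarTower.algebraMap_eq ℤ_[p] ℚ_[p] Kbar]
    exact (algebraMap ℚ_[p] Kbar).injective.comp (IsFractionRing.injective ℤ_[p] ℚ_[p])
  have : Module.Finite ℤ_[p] OK := IsIntegralClosure.finite ℤ_[p] ℚ_[p] K OK
  have : Module.IsTorsionFree ℤ_[p] K := Module.IsTorsionFree.trans_faithfulSMul ℤ_[p] ℚ_[p] K
  have : Module.IsTorsionFree ℤ_[p] OK := IsIntegralClosure.isTorsionFree ℤ_[p] K
  have hlevel : ∀ F : Set OKbar, F.Finite → ∃ S : Subalgebra OK OKbar, F ⊆ S ∧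
      Module.Finite ℤ_[p] S ∧ IsDiscreteValuationRing S ∧ Module.IsTorsionFree ℤ_[p] S :=
    fun F hF ↦ exists_subalgebra_isDiscreteValuationRing K Kbar hF
  have hd0 : d ≠ 0 := by
    rintro rfl
    exact (differentIdeal_eq_mul_of_charZero ℤ_[p] OK OK).1 (by simpa using hd)
  have hdmap : algebraMap OK Kbar d = algebraMap OKbar Kbar (algebraMap OK OKbar d) :=
    IsScalarTower.algebraMap_apply _ _ _ _
  have hdmap0 : algebraMap OK OKbar d ≠ 0 :=
    (map_ne_zero_iff _ (FaithfulSMul.algebraMap_injective OK OKbar)).mpr hd0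
  have hp1 : (0 : ℚ) < 1 / ((p : ℚ) - 1) :=
    one_div_pos.mpr (sub_pos.mpr (by exact_mod_cast hp.one_lt))
  have hprim : ∀ r, ∃ ζ : OKbar, IsPrimitiveRoot ζ (p ^ r) := by
    intro r
    have : NeZero ((p ^ r : ℕ) : Kbar) := ⟨by exact_mod_cast pow_ne_zero r hp.ne_zero⟩
    obtain ⟨z, hz⟩ := HasEnoughRootsOfUnity.exists_primitiveRoot Kbar (p ^ r)
    obtain ⟨ζ, rfl⟩ := (IsIntegralClosure.isIntegral_iff (A := OKbar)).mp
      ((hz.isIntegral (pow_pos hp.pos r)).tower_top (A := ℤ_[p]))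
    exact ⟨ζ, hz.of_map_of_injective hinj⟩
  have hker : ∀ (a ζ : OKbar) (r : ℕ), IsPrimitiveRoot ζ (p ^ r) →
      ((ζ ^ (p ^ r - 1) * a) • KaehlerDifferential.D OK OKbar ζ = 0 ↔
        a = 0 ∨ (r : ℚ) - v (algebraMap OK Kbar d) - 1 / ((p : ℚ) - 1) ≤
          v (algebraMap OKbar Kbar a)) := by
    intro a ζ r hζ
    rw [hdmap]
    rcases r with _ | k
    · obtain rfl : ζ = 1 := by simpa using hζ
      rw [Derivation.map_one_eq_zero, smul_zero, Nat.cast_zero]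
      refine iff_of_true rfl ((eq_or_ne a 0).imp_right fun ha ↦ ?_)
      linarith [hv_int a ha, hv_int _ hdmap0]
    · rw [← smul_D_eq_zero_iff_map_le hlevel hv_mul hv_p hv_int hd0 hd hζ, mul_smul,
        ((hζ.isUnit (pow_pos hp.pos _).ne').pow _).smul_eq_zero]
  have hsurj := exists_forall_eq_smul_D hlevel hv_mul hv_p hv_int hd0 hd
  refine ⟨fun ω ↦ ?_, hker, fun IK hIK ζ hζ hζp ↦ ?_⟩
  · obtain ⟨k, hk⟩ := hsurj ω
    obtain ⟨ζ, hζ⟩ := hprim (k + 1)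
    obtain ⟨a, rfl⟩ := hk ζ hζ
    exact ⟨ζ * a, ζ, k + 1, hζ, hζ.eq_pow_sub_one_mul_smul hp.pos a _⟩
  · have hpC : (p : OKbar) ≠ 0 := by exact_mod_cast hp.ne_zero
    have hpL : (p : Kbar) ≠ 0 := by exact_mod_cast hp.ne_zero
    have hdiv : ∀ x : Kbar, ∃ (a : OKbar) (r : ℕ), x = algebraMap OKbar Kbar a /
        algebraMap OKbar Kbar (p : OKbar) ^ r := by
      intro x
      rcases eq_or_ne x 0 with rfl | hx
      · exact ⟨0, 0, by simp⟩
      obtain ⟨r, hr⟩ := exists_nat_ge (-v x)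
      have hpr := pow_ne_zero r hpL
      obtain ⟨a, ha⟩ := exists_algebraMap_eq_of_nonneg hv_mul hv_p hv_int (mul_ne_zero hx hpr) (by
        rw [hv_mul _ _ hx hpr, map_pow_of_map_mul hv_mul hpL, hv_p]
        linarith)
      exact ⟨a, r, by rw [ha, map_natCast, mul_div_cancel_right₀ _ hpr]⟩
    obtain ⟨ψ, hψ⟩ := exists_addMonoidHom_div_pow hinj hpC hdiv
      (w := fun r ↦ ζ r ^ (p ^ r - 1) • KaehlerDifferential.D OK OKbar (ζ r)) fun r ↦ by
        rw [← pow_sub_one_smul_D_eq_natCast_smul hp.pos, hζp]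
    have hψ' : ∀ (a : OKbar) (r : ℕ), ψ (algebraMap OKbar Kbar a / (p : Kbar) ^ r) =
        (ζ r ^ (p ^ r - 1) * a) • KaehlerDifferential.D OK OKbar (ζ r) := by
      intro a r
      rw [mul_comm, mul_smul, ← hψ, map_natCast]
    have hψker : ψ.ker = IK := by
      ext x
      obtain ⟨a, r, rfl⟩ := hdiv x
      rw [map_natCast, AddMonoidHom.mem_ker, hψ', hker a _ r (hζ r), hIK]
      rcases eq_or_ne a 0 with rfl | ha
      · simp
      have ha' := (map_ne_zero_iff _ hinj).mpr ha
      have hpr := pow_ne_zero r hpL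
      rw [map_div_of_map_mul hv_mul ha' hpr, map_pow_of_map_mul hv_mul hpL, hv_p]
      simp only [ha, div_eq_zero_iff, ha', hpr, or_self, false_or]
      constructor <;> intro h <;> linarith
    have hψsurj : Function.Surjective ψ := by
      intro ω
      obtain ⟨k, hk⟩ := hsurj ω
      obtain ⟨a, rfl⟩ := hk _ (hζ (k + 1))
      exact ⟨algebraMap OKbar Kbar (ζ (k + 1) * a) / (p : Kbar) ^ (k + 1),
        by rw [hψ', ← (hζ (k + 1)).eq_pow_sub_one_mul_smul hp.pos]⟩
    refine ⟨(QuotientAddGroup.quotientAddEquivOfEq hψker.symm).trans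
      (QuotientAddGroup.quotientKerEquivOfSurjective ψ hψsurj), fun a r ↦ ?_⟩
    rw [← hψ']
    rfl
end

section
/- The O_K̄-module Ω¹_{O_K̄/O_K} is p-primary torsion (every element is annihilated by some power of p) and p-divisible, and the universal derivation d : O_K̄ → Ω¹_{O_K̄/O_K} is surjective. -/
open Polynomial

/-- An element killed by `1 + r` and by a power of a divisor of `r` is zero. -/
theorem eq_zero_of_one_add_smul_eq_zero {A M : Type*} [CommRing A] [AddCommGroup M] [Module A M]
    {r : A} {x : M} (h : (1 + r) • x = 0) {m : ℕ} (hr : r ^ m • x = 0) : x = 0 := by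
  induction m with
  | zero => simpa using hr
  | succ m ih =>
    refine ih ?_
    have := congrArg (fun y => r ^ m • y) h
    simpa [add_smul, mul_smul, smul_smul, ← pow_succ, hr, -smul_eq_zero] using this

theorem IsIntegralClosure.exists_isRoot_of_monic {R A L : Type*} [CommRing R] [CommRing A]
    [Field L] [IsAlgClosed L] [Algebra R A] [Algebra R L] [Algebra A L] [IsScalarTower R A L]
    [IsIntegralClosure A R L] {f : A[X]} (hf : f.Monic) (hd : f.natDegree ≠ 0) :
    ∃ c, f.eval c = 0 := by
  have hinj := IsIntegralClosure.algebraMap_injective A R L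
  have := IsIntegralClosure.isIntegral_algebra R (A := A) L
  obtain ⟨z, hz⟩ := IsAlgClosed.exists_root (f.map (algebraMap A L)) (by
    rw [hf.degree_map]
    intro h
    exact hd (natDegree_eq_of_degree_eq_some h))
  have hzA : IsIntegral A z := ⟨f, hf, by simpa [IsRoot, eval_map] using hz⟩
  have hzR : IsIntegral R z := isIntegral_trans z hzA
  refine ⟨IsIntegralClosure.mk' A z hzR, hinj ?_⟩
  rw [← eval₂_hom, IsIntegralClosure.algebraMap_mk', map_zero, ← eval_map]
  exact hz

theorem exists_pow_add_mul_eq_of_monic_roots {A : Type*} [CommRing A] [Nontrivial A]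
    (hroot : ∀ f : A[X], f.Monic → f.natDegree ≠ 0 → ∃ c, f.eval c = 0)
    {q : ℕ} (hq : 1 < q) (r a : A) : ∃ c, c ^ q + r * c = a := by
  have hlt : (C r * X - C a).degree < (q : WithBot ℕ) := by
    refine lt_of_le_of_lt (b := ((1 : ℕ) : WithBot ℕ)) ?_ (by exact_mod_cast hq)
    compute_degree
    simp
  obtain ⟨c, hc⟩ := hroot (X ^ q + (C r * X - C a)) (monic_X_pow_add hlt) (by
    rw [natDegree_eq_of_degree_eq_some (n := q) ?_]
    · lia
    · rw [degree_add_eq_left_of_degree_lt (by simpa using hlt), degree_X_pow])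
  refine ⟨c, ?_⟩
  simp only [eval_add, eval_pow, eval_X, eval_sub, eval_mul, eval_C] at hc
  linear_combination hc

namespace KaehlerDifferential

variable {R A : Type*} [CommRing R] [CommRing A] [Algebra R A]

theorem exists_nsmul_eq_of_exists_pow_eq (p : ℕ) (h : ∀ a : A, ∃ c, c ^ p = a)
    (x : Ω[A⁄R]) : ∃ y : Ω[A⁄R], p • y = x := by
  have hx : x ∈ Submodule.span A (Set.range (D R A)) := by
    rw [span_range_derivation]; trivial
  induction hx using Submodule.span_induction with
  | mem x hx =>
    obtain ⟨a, rfl⟩ := hx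
    obtain ⟨c, rfl⟩ := h a
    exact ⟨c ^ (p - 1) • D R A c, by rw [Derivation.leibniz_pow]⟩
  | zero => exact ⟨0, smul_zero _⟩
  | add x y _ _ hx hy =>
    obtain ⟨x', rfl⟩ := hx
    obtain ⟨y', rfl⟩ := hy
    exact ⟨x' + y', smul_add _ _ _⟩
  | smul a x _ hx =>
    obtain ⟨x', rfl⟩ := hx
    exact ⟨a • x', smul_comm _ _ _⟩

theorem exists_pow_smul_eq_zero (p : ℕ) (h : ∀ a : A, ∃ n : ℕ, (p ^ n : ℕ) • D R A a = 0)
    (x : Ω[A⁄R]) : ∃ n : ℕ, (p ^ n : ℕ) • x = 0 := by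
  have hx : x ∈ Submodule.span A (Set.range (D R A)) := by
    rw [span_range_derivation]; trivial
  induction hx using Submodule.span_induction with
  | mem x hx =>
    obtain ⟨a, rfl⟩ := hx
    exact h a
  | zero => exact ⟨0, smul_zero _⟩
  | add x y _ _ hx hy =>
    obtain ⟨m, hm⟩ := hx
    obtain ⟨n, hn⟩ := hy
    refine ⟨m + n, ?_⟩
    rw [smul_add, pow_add, mul_comm, mul_smul, hm, mul_comm, mul_smul, hn]
    simp
  | smul a x _ hx =>
    obtain ⟨n, hn⟩ := hx
    exact ⟨n, by rw [smul_comm, hn, smul_zero]⟩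

/-- The kernel of `d` is `p`-adically dense: every element is congruent to a closed one
modulo `p ^ n`. -/
theorem exists_D_eq_zero_and_eq_add_pow_mul {p : ℕ} (hp : 1 < p)
    (htors : ∀ x : Ω[A⁄R], ∃ n : ℕ, (p ^ n : ℕ) • x = 0)
    (hroot : ∀ q : ℕ, 1 < q → ∀ r a : A, ∃ c, c ^ q + r * c = a) (a : A) (n : ℕ) :
    ∃ b c : A, D R A b = 0 ∧ a = b + (p : A) ^ n * c := by
  obtain ⟨k, hk, hka⟩ : ∃ k : ℕ, k ≠ 0 ∧ (p : A) ^ k • D R A a = 0 := by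
    obtain ⟨k, hk⟩ := htors (D R A a)
    refine ⟨k + 1, by simp, ?_⟩
    rw [← Nat.cast_smul_eq_nsmul A, Nat.cast_pow] at hk
    rw [pow_succ', mul_smul, hk, smul_zero]
  -- a root `c` of `X ^ q + p ^ n * X - a` satisfies `(1 + p ^ k * c ^ (q - 1)) • d(c ^ q) = 0`
  set q := p ^ (n + k) with hq
  obtain ⟨c, hc⟩ := hroot q (Nat.one_lt_pow (by lia) hp) ((p : A) ^ n) a
  refine ⟨c ^ q, c, ?_, hc.symm⟩
  have hDq : D R A (c ^ q) = ((p : A) ^ (n + k) * c ^ (q - 1)) • D R A c := by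
    rw [Derivation.leibniz_pow, ← Nat.cast_smul_eq_nsmul A, smul_smul, hq, Nat.cast_pow]
  have hDa : D R A a = D R A (c ^ q) + (p : A) ^ n • D R A c := by
    have hpn : D R A ((p : A) ^ n) = 0 := by
      rw [← Nat.cast_pow]; exact Derivation.map_natCast _ _
    rw [← hc, map_add, Derivation.leibniz (D R A) ((p : A) ^ n) c, hpn, smul_zero, add_zero]
  have hmul : (1 + (p : A) ^ k * c ^ (q - 1)) • D R A (c ^ q) = 0 := by
    have h : ((p : A) ^ k * c ^ (q - 1)) • D R A a = 0 := by
      rw [mul_comm, mul_smul, hka, smul_zero]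
    rw [← h, hDa, hDq]
    module
  obtain ⟨m, hm⟩ := htors (D R A (c ^ q))
  rw [← Nat.cast_smul_eq_nsmul A, Nat.cast_pow] at hm
  refine eq_zero_of_one_add_smul_eq_zero hmul (m := m) ?_
  have : ((p : A) ^ k * c ^ (q - 1)) ^ m
      = ((p : A) ^ ((k - 1) * m) * c ^ ((q - 1) * m)) * (p : A) ^ m := by
    obtain ⟨j, rfl⟩ := Nat.exists_eq_succ_of_ne_zero hk
    simp only [Nat.succ_eq_add_one, Nat.add_sub_cancel, pow_mul]
    ring
  rw [this, mul_smul, hm, smul_zero]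

theorem D_surjective_of_exists_pow_add_mul_eq {p : ℕ} (hp : 1 < p)
    (htors : ∀ x : Ω[A⁄R], ∃ n : ℕ, (p ^ n : ℕ) • x = 0)
    (hroot : ∀ q : ℕ, 1 < q → ∀ r a : A, ∃ c, c ^ q + r * c = a) :
    Function.Surjective (D R A) := by
  intro x
  have hx : x ∈ Submodule.span A (Set.range (D R A)) := by
    rw [span_range_derivation]; trivial
  induction hx using Submodule.span_induction with
  | mem x hx => exact hx
  | zero => exact ⟨0, map_zero _⟩
  | add x y _ _ hx hy =>
    obtain ⟨x', rfl⟩ := hx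
    obtain ⟨y', rfl⟩ := hy
    exact ⟨x' + y', map_add _ _ _⟩
  | smul a x _ hx =>
    obtain ⟨b, rfl⟩ := hx
    obtain ⟨n, hn⟩ := htors (D R A b)
    rw [← Nat.cast_smul_eq_nsmul A, Nat.cast_pow] at hn
    obtain ⟨a₀, c, ha₀, rfl⟩ := exists_D_eq_zero_and_eq_add_pow_mul hp htors hroot a n
    refine ⟨a₀ * b, ?_⟩
    rw [Derivation.leibniz, ha₀, smul_zero, add_zero, add_smul, mul_comm, mul_smul, hn,
      smul_zero, add_zero]

/-- In an integral torsion-free extension of an integrally closed domain of characteristic zero,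
each `da` is killed by a nonzero scalar. -/
theorem exists_ne_zero_algebraMap_smul_D_eq_zero (S : Type*) [CommRing S] [IsDomain S]
    [IsIntegrallyClosed S] [CharZero S] [IsDomain A] [Algebra S R] [Algebra S A]
    [IsScalarTower S R A] [Module.IsTorsionFree S A] [Algebra.IsIntegral S A] (a : A) :
    ∃ s : S, s ≠ 0 ∧ algebraMap S A s • D R A a = 0 := by
  have ha : IsIntegral S a := Algebra.IsIntegral.isIntegral a
  have hdeg : (minpoly S a).natDegree ≠ 0 := (minpoly.natDegree_pos ha).ne'
  have hder : (minpoly S a).derivative ≠ 0 := by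
    intro h
    exact hdeg (derivative_eq_zero.mp h)
  have hne : aeval a (minpoly S a).derivative ≠ 0 := by
    intro h
    exact absurd (minpoly.IsIntegrallyClosed.degree_le_of_ne_zero hder h)
      (not_le.mpr (degree_derivative_lt (minpoly.ne_zero ha)))
  have hD : aeval a (minpoly S a).derivative • D R A a = 0 := by
    have := (D R A).map_aeval ((minpoly S a).map (algebraMap S R)) a
    rw [aeval_map_algebraMap, minpoly.aeval, map_zero, derivative_map,
      aeval_map_algebraMap] at this
    exact this.symm
  obtain ⟨s, hs, t, ht⟩ := (Algebra.IsIntegral.isIntegral (R := S)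
    (aeval a (minpoly S a).derivative)).isAlgebraic.exists_nonzero_dvd
    (mem_nonZeroDivisors_of_ne_zero hne)
  exact ⟨s, hs, by rw [ht, mul_comm, mul_smul, hD, smul_zero]⟩

end KaehlerDifferential


/-- Let `p` be a prime, `K` a finite extension of `ℚ_p` with ring of
integers `O_K`, `K̄` an algebraic closure of `K` with ring of integers `O_K̄` (the
integral closure of `ℤ_p`, equivalently of `O_K`).  Then the module of Kähler
differentials `Ω¹_{O_K̄/O_K}` is `p`-primary torsion and `p`-divisible, and the
universal derivation `d : O_K̄ → Ω¹_{O_K̄/O_K}` is surjective. -/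
theorem kaehler_of_ring_of_integers_pPrimary_pDivisible_d_surjective
    (p : ℕ) [Fact p.Prime]
    (K : Type*) [Field K] [Algebra ℚ_[p] K] [FiniteDimensional ℚ_[p] K]
    (Kbar : Type*) [Field Kbar] [Algebra K Kbar] [IsAlgClosure K Kbar]
    [Algebra ℤ_[p] K] [IsScalarTower ℤ_[p] ℚ_[p] K]
    [Algebra ℚ_[p] Kbar] [Algebra ℤ_[p] Kbar]
    [IsScalarTower ℤ_[p] ℚ_[p] Kbar] [IsScalarTower ℚ_[p] K Kbar]
    (OK : Type*) [CommRing OK] [Algebra ℤ_[p] OK] [Algebra OK K]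
    [IsScalarTower ℤ_[p] OK K] [IsIntegralClosure OK ℤ_[p] K]
    (OKbar : Type*) [CommRing OKbar] [Algebra ℤ_[p] OKbar] [Algebra OKbar Kbar]
    [IsScalarTower ℤ_[p] OKbar Kbar] [IsIntegralClosure OKbar ℤ_[p] Kbar]
    [Algebra OK OKbar] [Algebra OK Kbar] [IsScalarTower OK K Kbar]
    [IsScalarTower OK OKbar Kbar] :
    (∀ x : KaehlerDifferential OK OKbar, ∃ n : ℕ, (p ^ n : ℕ) • x = 0) ∧
    (∀ x : KaehlerDifferential OK OKbar, ∃ y : KaehlerDifferential OK OKbar,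
      (p : ℕ) • y = x) ∧
    Function.Surjective (KaehlerDifferential.D OK OKbar) := by
  have hp : 1 < p := (Fact.out : p.Prime).one_lt
  have : IsAlgClosed Kbar := IsAlgClosure.isAlgClosed K
  have hinjA : Function.Injective (algebraMap OKbar Kbar) :=
    IsIntegralClosure.algebraMap_injective OKbar ℤ_[p] Kbar
  have : IsDomain OKbar := hinjA.isDomain (algebraMap OKbar Kbar)
  have : Algebra.IsIntegral ℤ_[p] OKbar := IsIntegralClosure.isIntegral_algebra ℤ_[p] Kbar
  have htower : IsScalarTower ℤ_[p] OK OKbar := by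
    refine IsScalarTower.of_algebraMap_eq fun s => hinjA ?_
    rw [← IsScalarTower.algebraMap_apply ℤ_[p] OKbar Kbar,
      ← IsScalarTower.algebraMap_apply OK OKbar Kbar,
      IsScalarTower.algebraMap_apply OK K Kbar,
      ← IsScalarTower.algebraMap_apply ℤ_[p] OK K,
      IsScalarTower.algebraMap_apply ℤ_[p] ℚ_[p] K,
      ← IsScalarTower.algebraMap_apply ℚ_[p] K Kbar,
      ← IsScalarTower.algebraMap_apply ℤ_[p] ℚ_[p] Kbar]
  have : Module.IsTorsionFree ℤ_[p] OKbar := by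
    rw [Module.isTorsionFree_iff_algebraMap_injective]
    refine Function.Injective.of_comp (f := algebraMap OKbar Kbar) ?_
    rw [← RingHom.coe_comp, ← IsScalarTower.algebraMap_eq,
      IsScalarTower.algebraMap_eq ℤ_[p] ℚ_[p] Kbar]
    exact (algebraMap ℚ_[p] Kbar).injective.comp (IsFractionRing.injective ℤ_[p] ℚ_[p])
  have hroot : ∀ q : ℕ, 1 < q → ∀ r a : OKbar, ∃ c, c ^ q + r * c = a := fun q hq r a =>
    exists_pow_add_mul_eq_of_monic_roots
      (fun _ hf hd => IsIntegralClosure.exists_isRoot_of_monic (R := ℤ_[p]) (L := Kbar) hf hd)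
      hq r a
  have htors : ∀ x : KaehlerDifferential OK OKbar, ∃ n : ℕ, (p ^ n : ℕ) • x = 0 := by
    refine KaehlerDifferential.exists_pow_smul_eq_zero p fun a => ?_
    obtain ⟨s, hs, h⟩ :=
      KaehlerDifferential.exists_ne_zero_algebraMap_smul_D_eq_zero (R := OK) ℤ_[p] a
    obtain ⟨n, u, hu⟩ := IsDiscreteValuationRing.associated_pow_irreducible hs
      (PadicInt.irreducible_p (p := p))
    refine ⟨n, ?_⟩
    rw [← Nat.cast_smul_eq_nsmul OKbar, Nat.cast_pow, ← map_natCast (algebraMap ℤ_[p] OKbar) p,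
      ← map_pow, ← hu, map_mul, mul_comm, mul_smul, h, smul_zero]
  refine ⟨htors, KaehlerDifferential.exists_nsmul_eq_of_exists_pow_eq p fun a => ?_,
    KaehlerDifferential.D_surjective_of_exists_pow_add_mul_eq hp htors hroot⟩
  obtain ⟨c, hc⟩ := hroot p hp 0 a
  exact ⟨c, by simpa using hc⟩
end
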